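/- Let (V, τ_V) be a nuclear space, A a unital commutative ℝ-algebra generated by V, L a normalized linear functional on A with L(∑A²) ⊆ [0,∞), and Q a quadratic module in A. Suppose: (a) L(Q) ⊆ [0,∞); (b) for each v ∈ V, ∑_{n=1}^∞ L(v^{2n})^{-1/(2n)} = ∞; and (c) s_L|_V is τ_V-continuous. Then for every Hilbertian seminorm q on V with {α ∈ K_Q : α|_V is q-continuous} ≠ ∅ and tr(s_L|_V / q) < ∞, there exists a unique representing Radon measure ν for L such that ν({α ∈ K_Q : α|_V is q-continuous}) = 1. -/

import Mathlib

open MeasureTheory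
open scoped ENNReal

noncomputable section

/-- The character space `X(A)` of a unital commutative `ℝ`-algebra `A`:
the set of `ℝ`-algebra homomorphisms `A → ℝ`. -/
abbrev Character (A : Type*) [CommRing A] [Algebra ℝ A] := A →ₐ[ℝ] ℝ

/-- The weak topology on the character space: the weakest topology making all
evaluations `α ↦ α a` continuous. -/
instance Character.instTopologicalSpace (A : Type*) [CommRing A] [Algebra ℝ A] :
    TopologicalSpace (Character A) :=
  TopologicalSpace.induced (fun (α : Character A) (a : A) => α a) inferInstance

/-- The Borel σ-algebra on the character space. -/
instance Character.instMeasurableSpace (A : Type*) [CommRing A] [Algebra ℝ A] :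
    MeasurableSpace (Character A) :=
  borel (Character A)

/-- A Radon measure: a locally finite Borel measure that is inner regular with
respect to compact sets. -/
def IsRadonMeasure {X : Type*} [TopologicalSpace X] [MeasurableSpace X]
    (μ : Measure X) : Prop :=
  IsLocallyFiniteMeasure μ ∧ μ.InnerRegularWRT IsCompact MeasurableSet

/-- A Hilbertian seminorm on a real vector space `V`: a seminorm induced by a
symmetric positive semidefinite bilinear form, recorded by the form itself. -/
structure HilbSeminorm (V : Type*) [AddCommGroup V] [Module ℝ V] where
  bilin : V →ₗ[ℝ] V →ₗ[ℝ] ℝ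
  symm : ∀ v w, bilin v w = bilin w v
  nonneg : ∀ v, 0 ≤ bilin v v

namespace HilbSeminorm

variable {V W : Type*} [AddCommGroup V] [Module ℝ V] [AddCommGroup W] [Module ℝ W]

/-- The seminorm associated to a Hilbertian seminorm: `p v = √⟨v,v⟩ₚ`. -/
def toFun (p : HilbSeminorm V) (v : V) : ℝ := Real.sqrt (p.bilin v v)

/-- Pullback of a Hilbertian seminorm along a linear map (e.g. restriction to a
subspace along the inclusion). -/
def comp (p : HilbSeminorm V) (f : W →ₗ[ℝ] V) : HilbSeminorm W where
  bilin := LinearMap.compl₁₂ p.bilin f f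
  symm v w := by
    simp only [LinearMap.compl₁₂_apply]
    exact p.symm (f v) (f w)
  nonneg v := by
    simp only [LinearMap.compl₁₂_apply]
    exact p.nonneg (f v)

/-- The Hilbertian seminorm `c • p`, induced by the bilinear form `c² ⟨·,·⟩ₚ`. -/
def smul (p : HilbSeminorm V) (c : ℝ) : HilbSeminorm V where
  bilin := c ^ 2 • p.bilin
  symm v w := by
    simp only [LinearMap.smul_apply, smul_eq_mul]
    rw [p.symm v w]
  nonneg v := by
    simp only [LinearMap.smul_apply, smul_eq_mul]
    exact mul_nonneg (sq_nonneg c) (p.nonneg v)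

/-- A finite subset `E ⊆ V` is `q`-orthonormal. -/
def IsONS (q : HilbSeminorm V) (E : Finset V) : Prop :=
  (∀ e ∈ E, q.bilin e e = 1) ∧ ∀ e ∈ E, ∀ f ∈ E, e ≠ f → q.bilin e f = 0

open scoped Classical

/-- The trace `tr(p/q)` of a Hilbertian seminorm `p` with respect to a Hilbertian
seminorm `q`: the supremum over finite `q`-orthonormal sets `E` of `∑_{e∈E} p(e)²`
if `ker q ⊆ ker p`, and `∞` otherwise. -/
def trace (p q : HilbSeminorm V) : ℝ≥0∞ :=
  if ∀ v, q.bilin v v = 0 → p.bilin v v = 0 then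
    ⨆ (E : Finset V) (_ : q.IsONS E), ENNReal.ofReal (∑ e ∈ E, p.bilin e e)
  else ⊤

end HilbSeminorm

section AlgebraDefs

variable {A : Type*} [CommRing A] [Algebra ℝ A]

/-- The restriction `α|_V` of a character `α` is `q`-continuous. -/
def QContOn (V : Submodule ℝ A) (q : ↥V → ℝ) (α : Character A) : Prop :=
  ∃ C > 0, ∀ v : V, |α (v : A)| ≤ C * q v

/-- `J`: the family of all subalgebras of `A` generated by finite-dimensional
subspaces of `V`. -/
def finGenSubalgebras (V : Submodule ℝ A) : Set (Subalgebra ℝ A) :=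
  {S | ∃ W : Submodule ℝ A, W ≤ V ∧ FiniteDimensional ℝ ↥W ∧
    S = Algebra.adjoin ℝ (W : Set A)}

/-- The family `{ν_S : S ∈ J}` is `p`-concentrated. -/
def Concentrated (V : Submodule ℝ A) (J : Set (Subalgebra ℝ A)) (p : ↥V → ℝ)
    (ν : ∀ S : Subalgebra ℝ A, Measure (Character ↥S)) : Prop :=
  ∀ ε > (0 : ℝ), ∃ δ > (0 : ℝ), ∀ S ∈ J, ∀ v : V, ∀ hv : (v : A) ∈ S,
    p v ≤ δ → ν S {α : Character ↥S | 1 ≤ |α ⟨(v : A), hv⟩|} ≤ ENNReal.ofReal ε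

/-- A quadratic module in `A`. -/
def IsQuadraticModule (Q : Set A) : Prop :=
  (1 : A) ∈ Q ∧ (∀ x ∈ Q, ∀ y ∈ Q, x + y ∈ Q) ∧ ∀ a : A, ∀ x ∈ Q, a ^ 2 * x ∈ Q

/-- The nonnegativity set `K_Q ⊆ X(A)` of a quadratic module `Q`. -/
def charNonneg (Q : Set A) : Set (Character A) := {α | ∀ a ∈ Q, 0 ≤ α a}

/-- The nonnegativity set `K_{Q ∩ S} ⊆ X(S)` for a subalgebra `S`. -/
def charNonnegOn (Q : Set A) (S : Subalgebra ℝ A) : Set (Character ↥S) :=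
  {α | ∀ a : S, (a : A) ∈ Q → 0 ≤ α a}

/-- The Hilbertian seminorm `s_L(a) = √(L(a²))` induced by a `∑A²`-positive
linear functional `L`, via the bilinear form `(a,b) ↦ L(ab)`. -/
def sLSeminorm (L : A →ₗ[ℝ] ℝ) (hL : ∀ a : A, 0 ≤ L (a * a)) : HilbSeminorm A where
  bilin := (LinearMap.mul ℝ A).compr₂ L
  symm v w := by simp [mul_comm]
  nonneg v := by simpa using hL v

end AlgebraDefs

/-- `τ` is the topology induced by a directed family `P` of Hilbertian
seminorms. -/
def InducedByHilbFamily {V : Type*} [AddCommGroup V] [Module ℝ V]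
    (τ : TopologicalSpace V) (P : Set (HilbSeminorm V)) : Prop :=
  (∀ p ∈ P, ∀ q ∈ P, ∃ r ∈ P, ∀ v, p.toFun v ≤ r.toFun v ∧ q.toFun v ≤ r.toFun v) ∧
  ∀ v : V, (@nhds V τ v).HasBasis
    (fun pe : HilbSeminorm V × ℝ => pe.1 ∈ P ∧ 0 < pe.2)
    (fun pe => {w | pe.1.toFun (w - v) < pe.2})

/-- A topology is nuclear (in the sense of Yamasaki) if it is induced by a
directed family `P` of Hilbertian seminorms such that every `p ∈ P` admits
`q ∈ P` with `tr(p/q) < ∞`. -/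
def IsNuclearTopology {V : Type*} [AddCommGroup V] [Module ℝ V]
    (τ : TopologicalSpace V) : Prop :=
  ∃ P : Set (HilbSeminorm V), InducedByHilbFamily τ P ∧
    ∀ p ∈ P, ∃ q ∈ P, p.trace q < ⊤

end

/-- AM-GM for `N` numbers, in power form. -/
theorem prod_le_arith_mean_pow {n : ℕ} (hn : 0 < n) (z : ℕ → ℝ) (hz : ∀ k, 0 ≤ z k) :
    ∏ k ∈ Finset.range n, z k ≤ ((∑ k ∈ Finset.range n, z k) / n) ^ n := by
  have hn' : (n : ℝ) ≠ 0 := by positivity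
  have h := Real.geom_mean_le_arith_mean_weighted (Finset.range n) (fun _ => (1 / n : ℝ)) z
    (fun _ _ => by positivity) (by simp [hn']) (fun k _ => hz k)
  have h2 := pow_le_pow_left₀
    (Finset.prod_nonneg fun k _ => Real.rpow_nonneg (hz k) _) h n
  rw [← Finset.prod_pow] at h2
  refine le_trans (le_of_eq ?_) (h2.trans (le_of_eq ?_))
  · refine Finset.prod_congr rfl fun k _ => ?_
    rw [← Real.rpow_natCast, ← Real.rpow_mul (hz k)]
    simp [hn']
  · congr 1
    rw [← Finset.mul_sum]
    ring

/-- Carleman's inequality, in summability form. -/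
theorem summable_of_pow_le_prod {t u : ℕ → ℝ} (ht : ∀ n, 0 ≤ t n) (hu : ∀ n, 0 ≤ u n)
    (hsum : Summable t) (h : ∀ n, u n ^ (n + 1) ≤ ∏ k ∈ Finset.range (n + 1), t k) :
    Summable u := by
  set B : ℕ → ℝ := fun n => ∑ k ∈ Finset.range n, (k + 1 : ℝ) * t k with hB
  have hBnn : ∀ n, 0 ≤ B n := fun n => Finset.sum_nonneg fun k _ => by
    have := ht k; positivity
  set c : ℕ → ℝ := fun k => (k + 2 : ℝ) ^ (k + 1) / (k + 1 : ℝ) ^ k with hc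
  have hc0 : ∀ k, 0 ≤ c k := fun k => by positivity
  have hcprod : ∀ n : ℕ, ∏ k ∈ Finset.range n, c k = (n + 1 : ℝ) ^ n := by
    intro n
    induction n with
    | zero => simp
    | succ n ih =>
      rw [Finset.prod_range_succ, ih, hc]
      have : (n + 1 : ℝ) ^ n ≠ 0 := by positivity
      push_cast
      field_simp
      ring
  have hcle : ∀ k, c k ≤ 3 * (k + 1 : ℝ) := by
    intro k
    have h1 : c k = (k + 1 : ℝ) * ((k + 2 : ℝ) / (k + 1)) ^ (k + 1) := by
      rw [hc]; simp only [div_pow]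
      have : (k + 1 : ℝ) ^ k ≠ 0 := by positivity
      have : (k + 1 : ℝ) ^ (k + 1) ≠ 0 := by positivity
      field_simp
      ring
    have h2 : ((k + 2 : ℝ) / (k + 1)) ^ (k + 1) ≤ Real.exp 1 := by
      have h3 : (k + 2 : ℝ) / (k + 1) ≤ Real.exp (1 / (k + 1)) := by
        have := Real.add_one_le_exp (1 / (k + 1 : ℝ))
        refine le_trans (le_of_eq ?_) this
        field_simp
        ring
      calc ((k + 2 : ℝ) / (k + 1)) ^ (k + 1) ≤ (Real.exp (1 / (k + 1))) ^ (k + 1) :=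
            pow_le_pow_left₀ (by positivity) h3 _
        _ = Real.exp 1 := by
            rw [← Real.exp_nat_mul]
            congr 1
            push_cast
            field_simp
    have h4 := Real.exp_one_lt_d9
    rw [h1]
    have : (0 : ℝ) < k + 1 := by positivity
    nlinarith
  have hub : ∀ n : ℕ, u n ≤ 3 * (B (n + 1) / ((n + 1) * (n + 2))) := by
    intro n
    have h1 : (u n * (n + 2)) ^ (n + 1) ≤ ((∑ k ∈ Finset.range (n + 1), c k * t k) /
        (n + 1)) ^ (n + 1) := by
      have h2 := prod_le_arith_mean_pow n.succ_pos (fun k => c k * t k)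
        (fun k => mul_nonneg (hc0 k) (ht k))
      rw [Finset.prod_mul_distrib, hcprod] at h2
      push_cast at h2
      refine le_trans ?_ h2
      rw [mul_pow, mul_comm]
      have h5 : (n + 1 + 1 : ℝ) = n + 2 := by ring
      rw [h5]
      exact mul_le_mul_of_nonneg_left (h n) (by positivity)
    have h3 := le_of_pow_le_pow_left₀ n.succ_ne_zero
      (div_nonneg (Finset.sum_nonneg fun k _ => mul_nonneg (hc0 k) (ht k)) (by positivity)) h1
    have h4 : ∑ k ∈ Finset.range (n + 1), c k * t k ≤ 3 * B (n + 1) := by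
      rw [hB, Finset.mul_sum]
      refine Finset.sum_le_sum fun k _ => ?_
      have := mul_le_mul_of_nonneg_right (hcle k) (ht k)
      linarith
    have h5 : (0 : ℝ) < n + 2 := by positivity
    have h6 : (0 : ℝ) < n + 1 := by positivity
    rw [le_div_iff₀ h6] at h3
    rw [← mul_div_assoc, le_div_iff₀ (by positivity)]
    nlinarith
  have htel : ∀ N : ℕ, ∑ n ∈ Finset.range N, B (n + 1) / ((n + 1 : ℝ) * (n + 2))
      = ∑ k ∈ Finset.range N, t k - B N / (N + 1) := by
    intro N
    induction N with
    | zero => simp [hB]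
    | succ N ih =>
      rw [Finset.sum_range_succ, ih, Finset.sum_range_succ t]
      have hb : B (N + 1) = B N + (N + 1) * t N := by rw [hB]; simp [Finset.sum_range_succ]
      rw [hb]
      push_cast
      field_simp
      ring
  refine summable_of_sum_range_le (c := 3 * ∑' k, t k) hu fun N => ?_
  calc ∑ n ∈ Finset.range N, u n
      ≤ ∑ n ∈ Finset.range N, 3 * (B (n + 1) / ((n + 1 : ℝ) * (n + 2))) :=
        Finset.sum_le_sum fun n _ => hub n
    _ = 3 * (∑ k ∈ Finset.range N, t k - B N / (N + 1)) := by rw [← Finset.mul_sum, htel]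
    _ ≤ 3 * ∑' k, t k := by
        have h1 := hsum.sum_le_tsum (Finset.range N) (fun k _ => ht k)
        have h2 : 0 ≤ B N / (N + 1) := div_nonneg (hBnn N) (by positivity)
        linarith

section Lanczos

variable {E H : Type*} [AddCommGroup E] [Module ℂ E] [NormedAddCommGroup H]
  [InnerProductSpace ℂ H]

/-- The monic orthogonal vectors generated by a symmetric operator `T` from a vector `a`
(shifted by one, starting with `0`). -/
noncomputable def lanczos (ι : E →ₗ[ℂ] H) (T : E →ₗ[ℂ] E) (a : E) : ℕ → E
  | 0 => 0
  | 1 => a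
  | (n + 2) => T (lanczos ι T a (n + 1))
      - (inner ℂ (ι (lanczos ι T a (n + 1))) (ι (T (lanczos ι T a (n + 1))))
          / (‖ι (lanczos ι T a (n + 1))‖ ^ 2 : ℝ)) • lanczos ι T a (n + 1)
      - ((‖ι (lanczos ι T a (n + 1))‖ ^ 2 / ‖ι (lanczos ι T a n)‖ ^ 2 : ℝ) : ℂ) • lanczos ι T a n

variable {ι : E →ₗ[ℂ] H} {T : E →ₗ[ℂ] E} {a : E}

local notation "g" => lanczos ι T a

theorem lanczos_rec (hT : ∀ x y, inner ℂ (ι (T x)) (ι y) = inner ℂ (ι x) (ι (T y))) (n : ℕ) :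
    ∃ α : ℝ, (α : ℂ) * (‖ι (g (n + 1))‖ ^ 2 : ℝ)
        = inner ℂ (ι (g (n + 1))) (ι (T (g (n + 1)))) ∧
      g (n + 2) = T (g (n + 1)) - (α : ℂ) • g (n + 1)
        - ((‖ι (g (n + 1))‖ ^ 2 / ‖ι (g n)‖ ^ 2 : ℝ) : ℂ) • g n := by
  set w := inner ℂ (ι (g (n + 1))) (ι (T (g (n + 1)))) with hw
  have hreal : (w.re : ℂ) = w := by
    rw [← Complex.conj_eq_iff_re, hw, inner_conj_symm, hT]
  refine ⟨w.re / ‖ι (g (n + 1))‖ ^ 2, ?_, ?_⟩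
  · by_cases h0 : ι (g (n + 1)) = 0
    · simp [hw, h0]
    · have : (‖ι (g (n + 1))‖ : ℂ) ≠ 0 := by simpa using h0
      push_cast
      rw [hreal]
      field_simp
  · rw [lanczos]
    push_cast
    rw [hreal]

theorem lanczos_orthogonal (hT : ∀ x y, inner ℂ (ι (T x)) (ι y) = inner ℂ (ι x) (ι (T y)))
    (n : ℕ) : ∀ k < n, inner ℂ (ι (g n)) (ι (g k)) = 0 := by
  induction n using Nat.strong_induction_on with
  | _ n ih =>
  have ih' : ∀ m < n, ∀ k < n, m ≠ k → inner ℂ (ι (g m)) (ι (g k)) = 0 := by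
    intro m hm k hk hmk
    rcases lt_or_gt_of_ne hmk with h | h
    · exact inner_eq_zero_symm.1 (ih k hk m h)
    · exact ih m hm k h
  have hg0 : ι (g 0) = 0 := by simp [lanczos]
  rcases n with _ | _ | n
  · intro k hk; omega
  · intro k hk
    obtain rfl : k = 0 := by omega
    simp [hg0]
  obtain ⟨α, hα, hrec⟩ := lanczos_rec (a := a) hT n
  intro k hk
  rw [hrec]
  simp only [map_sub, map_smul, inner_sub_left, inner_smul_left, Complex.conj_ofReal]
  rcases (by omega : k = n + 1 ∨ k = n ∨ k < n) with rfl | rfl | hkn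
  · rw [ih' n (by omega) (n + 1) (by omega) (by omega), hT, ← hα, inner_self_eq_norm_sq_to_K]
    simp
  · rw [ih' (k + 1) (by omega) k (by omega) (by omega), hT, inner_self_eq_norm_sq_to_K]
    by_cases h0 : ι (g k) = 0
    · rw [← hT]; simp [h0]
    rcases k with _ | k
    · simp [hg0] at h0
    obtain ⟨α', hα', hrec'⟩ := lanczos_rec (a := a) hT k
    have : T (g (k + 1)) = g (k + 2) + (α' : ℂ) • g (k + 1)
        + ((‖ι (g (k + 1))‖ ^ 2 / ‖ι (g k)‖ ^ 2 : ℝ) : ℂ) • g k := by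
      rw [hrec']; abel
    rw [this]
    simp only [map_add, map_smul, inner_add_right, inner_smul_right]
    rw [ih' (k + 2) (by omega) (k + 1) (by omega) (by omega),
      ih' (k + 2) (by omega) k (by omega) (by omega), inner_self_eq_norm_sq_to_K]
    have h1 : (‖ι (g (k + 1))‖ : ℂ) ≠ 0 := by simpa using h0
    push_cast
    field_simp
    simp
    ring
  · rw [ih' (n + 1) (by omega) k (by omega) (by omega), ih' n (by omega) k (by omega) (by omega),
      hT]
    rcases k with _ | k
    · simp [show g 0 = 0 from rfl]
    obtain ⟨α', hα', hrec'⟩ := lanczos_rec (a := a) hT k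
    have : T (g (k + 1)) = g (k + 2) + (α' : ℂ) • g (k + 1)
        + ((‖ι (g (k + 1))‖ ^ 2 / ‖ι (g k)‖ ^ 2 : ℝ) : ℂ) • g k := by
      rw [hrec']; abel
    rw [this]
    simp only [map_add, map_smul, inner_add_right, inner_smul_right]
    rw [ih' (n + 1) (by omega) (k + 2) (by omega) (by omega),
      ih' (n + 1) (by omega) (k + 1) (by omega) (by omega),
      ih' (n + 1) (by omega) k (by omega) (by omega)]
    simp

theorem lanczos_inner_pow (hT : ∀ x y, inner ℂ (ι (T x)) (ι y) = inner ℂ (ι x) (ι (T y)))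
    (hpos : ∀ n, ι (g (n + 1)) ≠ 0) (k : ℕ) :
    (∀ n > k, inner ℂ (ι (g (n + 1))) (ι ((T ^ k) a)) = 0) ∧
      inner ℂ (ι (g (k + 1))) (ι ((T ^ k) a)) = ((‖ι (g (k + 1))‖ ^ 2 : ℝ) : ℂ) := by
  induction k with
  | zero =>
    have ha : a = g 1 := by simp [lanczos]
    constructor
    · intro n hn
      have h := lanczos_orthogonal (a := a) hT (n + 1) 1 (by omega)
      rw [← ha] at h
      simpa using h
    · simp only [pow_zero, zero_add, Module.End.one_apply]
      rw [← ha, inner_self_eq_norm_sq_to_K]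
      norm_cast
  | succ k ih =>
    have key : ∀ n, ∃ α : ℝ, inner ℂ (ι (g (n + 1))) (ι ((T ^ (k + 1)) a)) =
        inner ℂ (ι (g (n + 2))) (ι ((T ^ k) a)) + α * inner ℂ (ι (g (n + 1))) (ι ((T ^ k) a))
        + ((‖ι (g (n + 1))‖ ^ 2 / ‖ι (g n)‖ ^ 2 : ℝ) : ℂ) * inner ℂ (ι (g n)) (ι ((T ^ k) a)) := by
      intro n
      obtain ⟨α, hα, hrec⟩ := lanczos_rec (a := a) hT n
      refine ⟨α, ?_⟩
      rw [hrec, pow_succ', Module.End.mul_apply, ← hT]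
      simp only [map_sub, map_smul, inner_sub_left, inner_smul_left, Complex.conj_ofReal]
      ring
    constructor
    · intro n hn
      obtain ⟨α, h⟩ := key n
      obtain ⟨m, rfl⟩ : ∃ m, n = m + 1 := ⟨n - 1, by omega⟩
      rw [h, ih.1 (m + 2) (by omega), ih.1 (m + 1) (by omega), ih.1 m (by omega)]
      simp
    · obtain ⟨α, h⟩ := key (k + 1)
      rw [h, ih.1 (k + 2) (by omega), ih.1 (k + 1) (by omega), ih.2]
      have h1 : (‖ι (g (k + 1))‖ : ℂ) ≠ 0 := by simpa using hpos k
      push_cast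
      field_simp
      simp

theorem lanczos_norm_le (hT : ∀ x y, inner ℂ (ι (T x)) (ι y) = inner ℂ (ι x) (ι (T y)))
    (hpos : ∀ n, ι (g (n + 1)) ≠ 0) (k : ℕ) : ‖ι (g (k + 1))‖ ≤ ‖ι ((T ^ k) a)‖ := by
  have h := (lanczos_inner_pow hT hpos k).2
  have h2 := norm_inner_le_norm (𝕜 := ℂ) (ι (g (k + 1))) (ι ((T ^ k) a))
  rw [h, Complex.norm_real, Real.norm_of_nonneg (by positivity), sq] at h2
  exact le_of_mul_le_mul_left h2 (norm_pos_iff.2 (hpos k))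

end Lanczos

section QuasiAnalytic

variable {E H : Type*} [AddCommGroup E] [Module ℂ E] [NormedAddCommGroup H]
  [InnerProductSpace ℂ H] {ι : E →ₗ[ℂ] H} {T : E →ₗ[ℂ] E} {a : E}

/-- The Christoffel–Darboux recursion for a weak eigenvector `ξ` of a symmetric operator. -/
theorem lanczos_darboux_step (hT : ∀ x y, inner ℂ (ι (T x)) (ι y) = inner ℂ (ι x) (ι (T y)))
    {ξ : H} {s : ℂ} (hξ : ∀ y, inner ℂ ξ (ι (T y)) = s * inner ℂ ξ (ι y)) (n : ℕ)
    (hn : ι (lanczos ι T a (n + 1)) ≠ 0) :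
    (inner ℂ ξ (ι (lanczos ι T a (n + 2)))
        * starRingEnd ℂ (inner ℂ ξ (ι (lanczos ι T a (n + 1))))).im
        / ‖ι (lanczos ι T a (n + 1))‖ ^ 2 =
      s.im * (‖inner ℂ ξ (ι (lanczos ι T a (n + 1)))‖ ^ 2 / ‖ι (lanczos ι T a (n + 1))‖ ^ 2)
      + (inner ℂ ξ (ι (lanczos ι T a (n + 1)))
        * starRingEnd ℂ (inner ℂ ξ (ι (lanczos ι T a n)))).im / ‖ι (lanczos ι T a n)‖ ^ 2 := by
  obtain ⟨α, -, hrec⟩ := lanczos_rec (a := a) hT n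
  have hc : inner ℂ ξ (ι (lanczos ι T a (n + 2))) = (s - α) * inner ℂ ξ (ι (lanczos ι T a (n + 1)))
      - ((‖ι (lanczos ι T a (n + 1))‖ ^ 2 / ‖ι (lanczos ι T a n)‖ ^ 2 : ℝ) : ℂ)
        * inner ℂ ξ (ι (lanczos ι T a n)) := by
    rw [hrec]
    simp only [map_sub, map_smul, inner_sub_right, inner_smul_right, hξ]
    ring
  rw [hc]
  generalize inner ℂ ξ (ι (lanczos ι T a (n + 1))) = c₁
  generalize inner ℂ ξ (ι (lanczos ι T a n)) = c₀
  have hN : ‖ι (lanczos ι T a (n + 1))‖ ≠ 0 := norm_ne_zero_iff.2 hn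
  have h1 : ‖c₁‖ ^ 2 = c₁.re ^ 2 + c₁.im ^ 2 := by
    rw [Complex.sq_norm, Complex.normSq_apply]; ring
  rw [h1]
  simp only [Complex.mul_im, Complex.mul_re, Complex.sub_re, Complex.sub_im, Complex.ofReal_re,
    Complex.ofReal_im, Complex.conj_re, Complex.conj_im]
  by_cases h0 : ‖ι (lanczos ι T a n)‖ = 0
  · rw [h0]
    field_simp
    simp
    ring
  · field_simp
    ring

/-- A quasi-analytic vector of a symmetric operator is orthogonal to every weak eigenvector with
non-real eigenvalue. -/
theorem inner_eq_zero_of_quasiAnalytic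
    (hT : ∀ x y, inner ℂ (ι (T x)) (ι y) = inner ℂ (ι x) (ι (T y)))
    {ξ : H} {s : ℂ} (hs : s.im ≠ 0) (hξ : ∀ y, inner ℂ ξ (ι (T y)) = s * inner ℂ ξ (ι y))
    {u : ℕ → ℝ} (hu : ∀ n, 0 ≤ u n) (hns : ¬ Summable u) {K : ℝ}
    (hK : ∀ n, ‖ι ((T ^ (n + 1)) a)‖ * u n ^ (n + 1) ≤ K) :
    inner ℂ ξ (ι a) = 0 := by
  by_contra h0
  set c : ℕ → ℂ := fun n => inner ℂ ξ (ι (lanczos ι T a n)) with hc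
  set d : ℕ → ℝ := fun n => ‖ι (lanczos ι T a n)‖ with hd
  set γ : ℕ → ℝ := fun n => ‖c (n + 1)‖ / d (n + 1) with hγ
  have hc1 : c 1 ≠ 0 := h0
  have hdnn : ∀ n, 0 ≤ d n := fun n => norm_nonneg _
  have hcd : ∀ n, d n = 0 → c n = 0 := fun n hn => by
    simp only [hc]; rw [norm_eq_zero.1 hn, inner_zero_right]
  have hstep : ∀ n, d (n + 1) ≠ 0 →
      (c (n + 2) * starRingEnd ℂ (c (n + 1))).im / d (n + 1) ^ 2
        = s.im * γ n ^ 2 + (c (n + 1) * starRingEnd ℂ (c n)).im / d n ^ 2 := by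
    intro n hn
    have := lanczos_darboux_step (a := a) hT hξ n (norm_ne_zero_iff.1 hn)
    rw [hγ, div_pow]
    exact this
  have hclaim : ∀ n, (∀ k ≤ n, d (k + 1) ≠ 0) ∧
      (c (n + 2) * starRingEnd ℂ (c (n + 1))).im / d (n + 1) ^ 2
        = s.im * ∑ k ∈ Finset.range (n + 1), γ k ^ 2 := by
    intro n
    induction n with
    | zero =>
      have h1 : d 1 ≠ 0 := fun h => hc1 (hcd 1 h)
      refine ⟨fun k hk => by obtain rfl : k = 0 := by omega
                             exact h1, ?_⟩
      rw [hstep 0 h1]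
      have : c 0 = 0 := by simp [hc, lanczos]
      simp [this]
    | succ n ih =>
      have h1 : d (n + 2) ≠ 0 := by
        intro h
        have h2 := ih.2
        rw [hcd _ h] at h2
        simp only [zero_mul, Complex.zero_im, zero_div] at h2
        rcases mul_eq_zero.1 h2.symm with h3 | h3
        · exact hs h3
        · rw [Finset.sum_eq_zero_iff_of_nonneg (fun _ _ => sq_nonneg _)] at h3
          have h4 := h3 0 (by simp)
          have h5 : ‖c 1‖ / d 1 = 0 := by simpa [hγ] using h4
          rcases div_eq_zero_iff.1 h5 with h6 | h6
          · exact hc1 (norm_eq_zero.1 h6)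
          · exact ih.1 0 (by omega) h6
      refine ⟨fun k hk => ?_, ?_⟩
      · rcases Nat.lt_or_ge n k with h | h
        · obtain rfl : k = n + 1 := by omega
          exact h1
        · exact ih.1 k h
      · rw [hstep (n + 1) h1, ih.2, Finset.sum_range_succ _ (n + 1)]
        ring
  have hdne : ∀ n, d (n + 1) ≠ 0 := fun n => (hclaim n).1 n le_rfl
  have hdpos : ∀ n, 0 < d (n + 1) := fun n => lt_of_le_of_ne (hdnn _) (hdne n).symm
  have hγnn : ∀ n, 0 ≤ γ n := fun n => div_nonneg (norm_nonneg _) (hdnn _)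
  have hγ0 : 0 < γ 0 := div_pos (norm_pos_iff.2 hc1) (hdpos 0)
  -- Bessel inequality
  have hbessel : Summable fun n => γ n ^ 2 := by
    let e : ℕ → H := fun n => ((d (n + 1))⁻¹ : ℂ) • ι (lanczos ι T a (n + 1))
    have he : Orthonormal ℂ e := by
      constructor
      · intro n
        simp only [e, norm_smul, norm_inv, Complex.norm_real, Real.norm_of_nonneg (hdnn _)]
        exact inv_mul_cancel₀ (hdne n)
      · intro m n hmn
        simp only [e, inner_smul_left, inner_smul_right]
        have : inner ℂ (ι (lanczos ι T a (m + 1))) (ι (lanczos ι T a (n + 1))) = 0 := by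
          rcases lt_or_gt_of_ne hmn with h | h
          · exact inner_eq_zero_symm.1 (lanczos_orthogonal hT (n + 1) (m + 1) (by omega))
          · exact lanczos_orthogonal hT (m + 1) (n + 1) (by omega)
        rw [this]; simp
    have := he.inner_products_summable ξ
    refine this.congr fun n => ?_
    rw [norm_inner_symm]
    simp only [e, inner_smul_right, norm_mul, norm_inv, Complex.norm_real,
      Real.norm_of_nonneg (hdnn _), hγ, hc]
    rw [div_eq_inv_mul]
  set t : ℕ → ℝ := fun n => d (n + 1) / d (n + 2) with ht
  have htnn : ∀ n, 0 ≤ t n := fun n => div_nonneg (hdnn _) (hdnn _)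
  have htle : ∀ n, |s.im| * γ 0 ^ 2 * t n ≤ γ n ^ 2 + γ (n + 1) ^ 2 := by
    intro n
    have h1 := congrArg abs (hclaim n).2
    rw [abs_div, abs_mul, abs_of_nonneg (sq_nonneg (d (n + 1))),
      abs_of_nonneg (Finset.sum_nonneg fun k _ => sq_nonneg (γ k))] at h1
    have h2 : γ 0 ^ 2 ≤ ∑ k ∈ Finset.range (n + 1), γ k ^ 2 :=
      Finset.single_le_sum (f := fun k => γ k ^ 2) (fun k _ => sq_nonneg (γ k)) (by simp)
    have h3 := Complex.abs_im_le_norm (c (n + 2) * starRingEnd ℂ (c (n + 1)))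
    rw [norm_mul, RCLike.norm_conj] at h3
    have h4 : |s.im| * γ 0 ^ 2 ≤ ‖c (n + 2)‖ * ‖c (n + 1)‖ / d (n + 1) ^ 2 := by
      calc |s.im| * γ 0 ^ 2 ≤ |s.im| * ∑ k ∈ Finset.range (n + 1), γ k ^ 2 := by gcongr
        _ = _ := h1.symm
        _ ≤ _ := by gcongr
    have h5 : ‖c (n + 2)‖ * ‖c (n + 1)‖ / d (n + 1) ^ 2 * t n = γ n * γ (n + 1) := by
      have := hdne n
      have := hdne (n + 1)
      simp only [ht, hγ]
      field_simp
    calc |s.im| * γ 0 ^ 2 * t n ≤ ‖c (n + 2)‖ * ‖c (n + 1)‖ / d (n + 1) ^ 2 * t n := by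
          gcongr
      _ = γ n * γ (n + 1) := h5
      _ ≤ _ := by nlinarith [sq_nonneg (γ n - γ (n + 1)), sq_nonneg (γ n), sq_nonneg (γ (n + 1))]
  have htsum : Summable t := by
    have h1 : Summable fun n => γ n ^ 2 + γ (n + 1) ^ 2 :=
      hbessel.add ((summable_nat_add_iff 1).2 hbessel)
    have hpos : 0 < |s.im| * γ 0 ^ 2 := by positivity
    have h2 : Summable fun n => |s.im| * γ 0 ^ 2 * t n :=
      h1.of_nonneg_of_le (fun n => mul_nonneg hpos.le (htnn n)) htle
    exact (summable_mul_left_iff hpos.ne').1 h2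
  have hprod : ∀ n, ∏ k ∈ Finset.range n, t k = d 1 / d (n + 1) := by
    intro n
    induction n with
    | zero => simp [div_self (hdne 0)]
    | succ n ih =>
      rw [Finset.prod_range_succ, ih]
      have := hdne n
      simp only [ht]
      field_simp
  set K' := max K 1
  have hK' : 0 < K' := by positivity
  set κ := min 1 (d 1 / K')
  have hκ : 0 < κ := lt_min one_pos (div_pos (hdpos 0) hK')
  refine hns ((summable_mul_left_iff hκ.ne').1
    (summable_of_pow_le_prod htnn (fun n => mul_nonneg hκ.le (hu n)) htsum fun n => ?_))
  rw [hprod, mul_pow, le_div_iff₀ (hdpos _)]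
  have h1 : κ ^ (n + 1) ≤ d 1 / K' :=
    (pow_le_of_le_one hκ.le (min_le_left _ _) n.succ_ne_zero).trans (min_le_right _ _)
  have h2 : u n ^ (n + 1) * d (n + 2) ≤ K' := by
    refine le_trans ?_ ((hK n).trans (le_max_left _ _))
    rw [mul_comm]
    exact mul_le_mul_of_nonneg_right
      (lanczos_norm_le hT (fun m => norm_ne_zero_iff.1 (hdne m)) (n + 1)) (pow_nonneg (hu n) _)
  calc κ ^ (n + 1) * u n ^ (n + 1) * d (n + 2)
      = κ ^ (n + 1) * (u n ^ (n + 1) * d (n + 2)) := by ring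
    _ ≤ d 1 / K' * K' := mul_le_mul h1 h2 (mul_nonneg (pow_nonneg (hu n) _) (hdnn _))
        (div_nonneg (hdnn _) hK'.le)
    _ = d 1 := by field_simp

/-- The same for a Hankel-type sequence `x n` in place of `T ^ n a`. -/
theorem inner_eq_zero_of_hankel {x : ℕ → H}
    (hx : ∀ m n, inner ℂ (x (m + 1)) (x n) = inner ℂ (x m) (x (n + 1)))
    {ξ : H} {s : ℂ} (hs : s.im ≠ 0) (hξ : ∀ n, inner ℂ ξ (x (n + 1)) = s * inner ℂ ξ (x n))
    {u : ℕ → ℝ} (hu : ∀ n, 0 ≤ u n) (hns : ¬ Summable u) {K : ℝ}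
    (hK : ∀ n, ‖x (n + 1)‖ * u n ^ (n + 1) ≤ K) :
    inner ℂ ξ (x 0) = 0 := by
  let ι : Polynomial ℂ →ₗ[ℂ] H := (Polynomial.basisMonomials ℂ).constr ℂ x
  let T : Polynomial ℂ →ₗ[ℂ] Polynomial ℂ := LinearMap.mulLeft ℂ Polynomial.X
  have hι : ∀ n, ι (Polynomial.X ^ n) = x n := fun n => by
    rw [← Polynomial.monomial_one_right_eq_X_pow]
    exact (Polynomial.basisMonomials ℂ).constr_basis ℂ x n
  have hTp : ∀ n, (T ^ n) 1 = Polynomial.X ^ n := by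
    intro n
    induction n with
    | zero => simp
    | succ n ih => rw [pow_succ', Module.End.mul_apply, ih, pow_succ']; rfl
  have hTX : ∀ n, T (Polynomial.X ^ n) = Polynomial.X ^ (n + 1) := fun n => by
    rw [pow_succ']; rfl
  have key := inner_eq_zero_of_quasiAnalytic (ι := ι) (T := T) (a := 1) (ξ := ξ) (s := s)
    (u := u) (K := K) ?_ hs ?_ hu hns ?_
  · rwa [← hι 0, pow_zero]
  · intro p q
    induction p using Polynomial.induction_on' with
    | add p q' hp hq => simp only [map_add, inner_add_left, hp, hq]
    | monomial m c =>
      induction q using Polynomial.induction_on' with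
      | add p q' hp hq => simp only [map_add, inner_add_right, hp, hq]
      | monomial n c' =>
        rw [← Polynomial.smul_X_eq_monomial, ← Polynomial.smul_X_eq_monomial]
        simp only [map_smul, inner_smul_left, inner_smul_right, hTX, hι, hx]
  · intro p
    induction p using Polynomial.induction_on' with
    | add p q' hp hq => simp only [map_add, inner_add_right, hp, hq, mul_add]
    | monomial m c =>
      rw [← Polynomial.smul_X_eq_monomial]
      simp only [map_smul, inner_smul_right, hTX, hι, hξ]
      ring
  · intro n
    rw [hTp, hι]
    exact hK n

end QuasiAnalytic

section Carleman

theorem pow_succ_le_pow_of_log_convex {m : ℕ → ℝ} (hm : ∀ k, 0 ≤ m k) (h0 : m 0 = 1)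
    (hlc : ∀ k, m (k + 1) ^ 2 ≤ m k * m (k + 2)) (k : ℕ) : m k ^ (k + 1) ≤ m (k + 1) ^ k := by
  induction k with
  | zero => simp [h0]
  | succ k ih =>
    rcases (hm (k + 1)).eq_or_lt with h | h
    · rw [← h, zero_pow (by omega)]
      exact pow_nonneg (hm _) _
    · refine le_of_mul_le_mul_left ?_ (pow_pos h k)
      calc m (k + 1) ^ k * m (k + 1) ^ (k + 1 + 1) = (m (k + 1) ^ 2) ^ (k + 1) := by ring
        _ ≤ (m k * m (k + 2)) ^ (k + 1) := by gcongr; exact hlc k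
        _ = m k ^ (k + 1) * m (k + 2) ^ (k + 1) := by ring
        _ ≤ m (k + 1) ^ k * m (k + 1 + 1) ^ (k + 1) :=
          mul_le_mul_of_nonneg_right ih (pow_nonneg (hm _) _)

theorem rpow_le_rpow_of_log_convex {m : ℕ → ℝ} (hm : ∀ k, 0 ≤ m k) (h0 : m 0 = 1)
    (hlc : ∀ k, m (k + 1) ^ 2 ≤ m k * m (k + 2)) :
    Monotone fun n : ℕ => m (n + 1) ^ ((1 : ℝ) / (2 * (n + 1) : ℝ)) := by
  refine monotone_nat_of_le_succ fun n => ?_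
  have h := Real.rpow_le_rpow (pow_nonneg (hm _) _)
    (pow_succ_le_pow_of_log_convex hm h0 hlc (n + 1))
    (show (0 : ℝ) ≤ 1 / (2 * (n + 1) * (n + 2)) by positivity)
  rw [← Real.rpow_natCast, ← Real.rpow_natCast, ← Real.rpow_mul (hm _), ← Real.rpow_mul (hm _)] at h
  rw [show ((n + 1 + 1 : ℕ) : ℝ) * (1 / (2 * (n + 1) * (n + 2))) = 1 / (2 * (n + 1)) by
      push_cast; field_simp; ring,
    show ((n + 1 : ℕ) : ℝ) * (1 / (2 * (n + 1) * (n + 2))) = 1 / (2 * ((n + 1 : ℕ) + 1)) by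
      push_cast; field_simp; ring] at h
  exact h

/-- The Carleman condition passes to the moments with index divisible by four. -/
theorem exists_not_summable_of_carleman {m : ℕ → ℝ} (hm : ∀ k, 0 ≤ m k) (h0 : m 0 = 1)
    (hlc : ∀ k, m (k + 1) ^ 2 ≤ m k * m (k + 2))
    (hC : ∑' n : ℕ, (ENNReal.ofReal (m (n + 1) ^ ((1 : ℝ) / (2 * (n + 1) : ℝ))))⁻¹ = ⊤) :
    ∃ u : ℕ → ℝ, (∀ n, 0 ≤ u n) ∧ ¬ Summable u ∧
      ∀ n, m (2 * (n + 1)) * u n ^ (4 * (n + 1)) ≤ 1 := by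
  have hmono := rpow_le_rpow_of_log_convex hm h0 hlc
  set r : ℕ → ℝ := fun n : ℕ => m (n + 1) ^ ((1 : ℝ) / (2 * (n + 1) : ℝ)) with hr
  have hrpow : ∀ n, r n ^ (2 * (n + 1)) = m (n + 1) := fun n => by
    rw [hr]
    simp only
    rw [← Real.rpow_natCast, ← Real.rpow_mul (hm _)]
    push_cast
    rw [one_div_mul_cancel (by positivity), Real.rpow_one]
  have hrnn : ∀ n, 0 ≤ r n := fun n => Real.rpow_nonneg (hm _) _
  by_cases hz : ∀ n, 0 < r n
  · refine ⟨fun n => (r (2 * n + 1))⁻¹, fun n => inv_nonneg.2 (hrnn _), fun hs => ?_, fun n => ?_⟩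
    · have hs2 : Summable fun n => (r (2 * n + 1 + 1))⁻¹ :=
        hs.of_nonneg_of_le (fun n => inv_nonneg.2 (hrnn _))
          fun n => inv_anti₀ (hz _) (hmono (Nat.le_succ _))
      have hs3 : Summable fun n => (r (n + 1))⁻¹ :=
        (HasSum.even_add_odd (f := fun n => (r (n + 1))⁻¹) hs.hasSum hs2.hasSum).summable
      have hs4 : Summable fun n => (r n)⁻¹ := (summable_nat_add_iff 1).1 hs3
      refine ENNReal.ofReal_ne_top (r := ∑' n, (r n)⁻¹) ?_
      rw [ENNReal.ofReal_tsum_of_nonneg (fun n => inv_nonneg.2 (hrnn n)) hs4, ← hC]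
      exact tsum_congr fun n => ENNReal.ofReal_inv_of_pos (hz n)
    · have h := hrpow (2 * n + 1)
      rw [show 2 * (n + 1) = 2 * n + 1 + 1 by ring, ← h, inv_pow,
        show 4 * (n + 1) = 2 * (2 * n + 1 + 1) by ring]
      exact (mul_inv_cancel₀ (pow_pos (hz _) _).ne').le
  · push Not at hz
    obtain ⟨n, hn⟩ := hz
    have h1 : m 1 = 0 := by
      rw [← zero_add 1, ← hrpow 0, (hmono (Nat.zero_le n)).trans hn |>.antisymm (hrnn 0)]
      simp
    have hall : ∀ k, m (k + 1) = 0 := by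
      intro k
      induction k with
      | zero => exact h1
      | succ k ih =>
        have h2 := hlc (k + 1)
        rw [ih, zero_mul] at h2
        exact pow_eq_zero_iff two_ne_zero |>.1 (le_antisymm h2 (sq_nonneg _))
    refine ⟨fun _ => 1, fun _ => zero_le_one, fun hs => ?_, fun n => ?_⟩
    · simpa using (summable_const_iff (β := ℕ) (G := ℝ) 1).1 hs
    · rw [show 2 * (n + 1) = 2 * n + 1 + 1 by ring, hall]
      simp

end Carleman

section GNS

open scoped TensorProduct ComplexConjugate

variable {A : Type*} [CommRing A] [Algebra ℝ A]

/-- The complex conjugation of the complexification of a real algebra. -/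
noncomputable def conjTensor (A : Type*) [CommRing A] [Algebra ℝ A] :
    (ℂ ⊗[ℝ] A) →ₐ[ℝ] (ℂ ⊗[ℝ] A) :=
  Algebra.TensorProduct.map (Complex.conjAe : ℂ →ₐ[ℝ] ℂ) (AlgHom.id ℝ A)

/-- The complexification of a real linear functional. -/
noncomputable def complexifyFunctional (L : A →ₗ[ℝ] ℝ) : (ℂ ⊗[ℝ] A) →ₗ[ℂ] ℂ :=
  (TensorProduct.AlgebraTensorModule.rid ℝ ℂ ℂ).toLinearMap ∘ₗ L.baseChange ℂ

@[simp]
theorem conjTensor_tmul (z : ℂ) (a : A) : conjTensor A (z ⊗ₜ a) = conj z ⊗ₜ a := by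
  simp [conjTensor]

@[simp]
theorem complexifyFunctional_tmul (L : A →ₗ[ℝ] ℝ) (z : ℂ) (a : A) :
    complexifyFunctional L (z ⊗ₜ a) = L a * z := by
  simp [complexifyFunctional]

theorem conjTensor_conjTensor (x : ℂ ⊗[ℝ] A) : conjTensor A (conjTensor A x) = x := by
  induction x using TensorProduct.induction_on with
  | zero => simp
  | tmul z a => simp
  | add x y hx hy => simp [hx, hy]

theorem conjTensor_smul (z : ℂ) (x : ℂ ⊗[ℝ] A) :
    conjTensor A (z • x) = conj z • conjTensor A x := by
  induction x using TensorProduct.induction_on with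
  | zero => simp
  | tmul w a => simp [TensorProduct.smul_tmul']
  | add x y hx hy => simp [hx, hy]

theorem complexifyFunctional_conjTensor (L : A →ₗ[ℝ] ℝ) (x : ℂ ⊗[ℝ] A) :
    complexifyFunctional L (conjTensor A x) = conj (complexifyFunctional L x) := by
  induction x using TensorProduct.induction_on with
  | zero => simp
  | tmul w a => simp
  | add x y hx hy => simp [hx, hy]

theorem exists_eq_tmul_add_tmul (x : ℂ ⊗[ℝ] A) :
    ∃ a b : A, x = (1 : ℂ) ⊗ₜ[ℝ] a + Complex.I ⊗ₜ[ℝ] b := by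
  induction x using TensorProduct.induction_on with
  | zero => exact ⟨0, 0, by simp⟩
  | tmul z a =>
    refine ⟨z.re • a, z.im • a, ?_⟩
    rw [← TensorProduct.smul_tmul, ← TensorProduct.smul_tmul, ← TensorProduct.add_tmul]
    congr 1
    apply Complex.ext <;> simp
  | add x y hx hy =>
    obtain ⟨a, b, rfl⟩ := hx
    obtain ⟨c, d, rfl⟩ := hy
    exact ⟨a + c, b + d, by simp only [TensorProduct.tmul_add]; abel⟩

theorem complexifyFunctional_conj_mul_self (L : A →ₗ[ℝ] ℝ) (a b : A) :
    complexifyFunctional L (conjTensor A ((1 : ℂ) ⊗ₜ[ℝ] a + Complex.I ⊗ₜ[ℝ] b) *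
      ((1 : ℂ) ⊗ₜ[ℝ] a + Complex.I ⊗ₜ[ℝ] b)) = ((L (a * a) + L (b * b) : ℝ) : ℂ) := by
  simp only [map_add, conjTensor_tmul, add_mul, mul_add, Algebra.TensorProduct.tmul_mul_tmul,
    complexifyFunctional_tmul, mul_comm b a]
  simp

/-- The sesquilinear form on the complexification of a real algebra induced by a positive
linear functional. -/
@[reducible]
noncomputable def gnsCore (L : A →ₗ[ℝ] ℝ) (hL : ∀ a, 0 ≤ L (a * a)) :
    PreInnerProductSpace.Core ℂ (ℂ ⊗[ℝ] A) where
  inner x y := complexifyFunctional L (conjTensor A x * y)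
  conj_inner_symm x y := by
    rw [← complexifyFunctional_conjTensor, map_mul, conjTensor_conjTensor, mul_comm]
  re_inner_nonneg x := by
    obtain ⟨a, b, rfl⟩ := exists_eq_tmul_add_tmul x
    rw [complexifyFunctional_conj_mul_self]
    exact add_nonneg (hL a) (hL b)
  add_left x y z := by rw [map_add, add_mul, map_add]
  smul_left x y z := by rw [conjTensor_smul, smul_mul_assoc, map_smul, smul_eq_mul]

/-- The Gelfand–Naimark–Segal representation. -/
theorem exists_gns.{u} {A : Type u} [CommRing A] [Algebra ℝ A]
    (L : A →ₗ[ℝ] ℝ) (hL : ∀ a, 0 ≤ L (a * a)) :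
    ∃ (H : Type u) (_ : NormedAddCommGroup H) (_ : InnerProductSpace ℂ H) (_ : CompleteSpace H)
      (ι : (ℂ ⊗[ℝ] A) →ₗ[ℂ] H), DenseRange ι ∧
        ∀ x y, inner ℂ (ι x) (ι y) = complexifyFunctional L (conjTensor A x * y) := by
  let core := gnsCore L hL
  let : SeminormedAddCommGroup (ℂ ⊗[ℝ] A) :=
    InnerProductSpace.Core.toSeminormedAddCommGroup (𝕜 := ℂ)
  let : InnerProductSpace ℂ (ℂ ⊗[ℝ] A) := InnerProductSpace.ofCore core
  refine ⟨UniformSpace.Completion (ℂ ⊗[ℝ] A), inferInstance, inferInstance, inferInstance,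
    (UniformSpace.Completion.toComplL (𝕜 := ℂ) (E := ℂ ⊗[ℝ] A)).toLinearMap,
    UniformSpace.Completion.denseRange_coe, fun x y => ?_⟩
  exact UniformSpace.Completion.inner_coe x y

end GNS

section Resolvent

open scoped ComplexConjugate InnerProductSpace
open ContinuousLinearMap

variable {D H : Type*} [CommRing D] [Algebra ℂ D] [NormedAddCommGroup H]
  [InnerProductSpace ℂ H]

/-- Multiplication by `v` is a symmetric operator (with respect to the pull-back under `ι` of the
inner product) for which all vectors are quasi-analytic. -/
structure IsQuasiAnalytic (ι : D →ₗ[ℂ] H) (v : D) : Prop where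
  symm : ∀ x y, inner ℂ (ι (v * x)) (ι y) = inner ℂ (ι x) (ι (v * y))
  carleman : ∀ x, ∃ u : ℕ → ℝ, (∀ n, 0 ≤ u n) ∧ ¬ Summable u ∧
    ∃ K, ∀ n, ‖ι (v ^ (n + 1) * x)‖ * u n ^ (n + 1) ≤ K

/-- `R` inverts multiplication by `w`. -/
def IsInverse (ι : D →ₗ[ℂ] H) (w : D) (R : H →L[ℂ] H) : Prop := ∀ x, R (ι (w * x)) = ι x

variable {ι : D →ₗ[ℂ] H} {v w w' : D} {R S : H →L[ℂ] H} {z : ℂ}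

theorem IsQuasiAnalytic.inner_eq_zero (hv : IsQuasiAnalytic ι v) (hz : z.im ≠ 0) {ξ : H}
    (hξ : ∀ x, inner ℂ ξ (ι ((v + algebraMap ℂ D z) * (w * x))) = 0) (x : D) :
    inner ℂ ξ (ι (w * x)) = 0 := by
  obtain ⟨u, hu, hns, K, hK⟩ := hv.carleman (w * x)
  have := inner_eq_zero_of_hankel (x := fun n => ι (v ^ n * (w * x))) (ξ := ξ) (s := -z) (u := u)
    (K := K) (fun m n => ?_) (by simpa using hz) (fun n => ?_) hu hns hK
  · simpa using this
  · simp only [pow_succ', mul_assoc]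
    exact hv.symm _ _
  · have h := hξ (v ^ n * x)
    rw [add_mul, map_add, inner_add_right, ← Algebra.smul_def, map_smul, inner_smul_right] at h
    simp only [pow_succ', mul_assoc, mul_left_comm (v ^ n) w]
    linear_combination h

theorem denseRange_comp_mulLeft [CompleteSpace H] (hv : IsQuasiAnalytic ι v) (hz : z.im ≠ 0)
    (hw : DenseRange (ι ∘ₗ LinearMap.mulLeft ℂ w)) :
    DenseRange (ι ∘ₗ LinearMap.mulLeft ℂ ((v + algebraMap ℂ D z) * w)) := by
  have key : ∀ f : D →ₗ[ℂ] H, DenseRange f ↔ ∀ ξ, (∀ x, inner ℂ ξ (f x) = 0) → ξ = 0 := by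
    intro f
    rw [DenseRange, ← LinearMap.coe_range, Submodule.dense_iff_topologicalClosure_eq_top,
      Submodule.topologicalClosure_eq_top_iff, Submodule.eq_bot_iff]
    simp [Submodule.mem_orthogonal']
  rw [key] at hw ⊢
  intro ξ hξ
  refine hw ξ fun x => ?_
  exact hv.inner_eq_zero hz (fun x => by simpa [mul_assoc] using hξ x) x

theorem IsQuasiAnalytic.denseRange [CompleteSpace H] (hι : DenseRange ι)
    (hv : IsQuasiAnalytic ι v) (hz : z.im ≠ 0) :
    DenseRange (ι ∘ₗ LinearMap.mulLeft ℂ (v + algebraMap ℂ D z)) := by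
  simpa using denseRange_comp_mulLeft (w := 1) hv hz (by simpa using hι)

theorem IsQuasiAnalytic.denseRange_mul [CompleteSpace H] (hι : DenseRange ι)
    (hv : IsQuasiAnalytic ι v) (hw : IsQuasiAnalytic ι w) (hz : z.im ≠ 0) {z' : ℂ}
    (hz' : z'.im ≠ 0) :
    DenseRange (ι ∘ₗ LinearMap.mulLeft ℂ ((v + algebraMap ℂ D z) * (w + algebraMap ℂ D z'))) :=
  denseRange_comp_mulLeft hv hz (hw.denseRange hι hz')

theorem ext_of_denseRange (hw : DenseRange (ι ∘ₗ LinearMap.mulLeft ℂ w))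
    (h : ∀ x, R (ι (w * x)) = S (ι (w * x))) : R = S := by
  have := hw.equalizer R.continuous S.continuous (funext fun x => h x)
  exact DFunLike.coe_injective this

theorem IsInverse.commute (hR : IsInverse ι w R) (hS : IsInverse ι w' S)
    (hd : DenseRange (ι ∘ₗ LinearMap.mulLeft ℂ (w * w'))) : Commute R S := by
  refine ext_of_denseRange hd fun x => ?_
  simp only [mul_apply_eq_comp]
  rw [mul_assoc, hR, mul_left_comm, hS, hS, hR]

theorem isInverse_star [CompleteSpace H] (hv : IsQuasiAnalytic ι v) (hz : z.im ≠ 0)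
    (hι : DenseRange ι) (hR : IsInverse ι (v + algebraMap ℂ D z) R) :
    IsInverse ι (v + algebraMap ℂ D (conj z)) (star R) := by
  intro x
  refine (hv.denseRange hι hz).eq_of_inner_right (𝕜 := ℂ) ?_
  intro y
  simp only [LinearMap.comp_apply, LinearMap.mulLeft_apply, star_eq_adjoint]
  rw [adjoint_inner_right, hR]
  simp only [add_mul, map_add, inner_add_left, inner_add_right, ← Algebra.smul_def, map_smul,
    inner_smul_left, inner_smul_right, hv.symm]

theorem IsQuasiAnalytic.norm_le (hv : IsQuasiAnalytic ι v) (x : D) :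
    ‖ι x‖ ≤ ‖ι ((v + algebraMap ℂ D Complex.I) * x)‖ := by
  refine le_of_sq_le_sq ?_ (norm_nonneg _)
  have h0 : (inner ℂ (ι (v * x)) (ι x)).im = 0 := by
    have := inner_conj_symm (𝕜 := ℂ) (ι x) (ι (v * x))
    rw [hv.symm] at this ⊢
    exact Complex.conj_eq_iff_im.1 this
  rw [add_mul, map_add, ← Algebra.smul_def, map_smul, norm_add_sq (𝕜 := ℂ), inner_smul_right,
    norm_smul, Complex.norm_I, one_mul]
  simp [h0]

theorem exists_isInverse [CompleteSpace H] (hι : DenseRange ι) (hv : IsQuasiAnalytic ι v) :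
    ∃ R : H →L[ℂ] H, IsInverse ι (v + algebraMap ℂ D Complex.I) R ∧ ‖R‖ ≤ 1 := by
  have hd := hv.denseRange hι (z := Complex.I) (by simp)
  have hn : ∀ x, ‖ι x‖ ≤ 1 * ‖(ι ∘ₗ LinearMap.mulLeft ℂ (v + algebraMap ℂ D Complex.I)) x‖ := by
    simpa using hv.norm_le
  exact ⟨_, fun x => LinearMap.extendOfNorm_eq hd ⟨1, hn⟩ x,
    LinearMap.opNorm_extendOfNorm_le hd zero_le_one hn⟩

end Resolvent

section Spectral


variable {H : Type*} [NormedAddCommGroup H] [InnerProductSpace ℂ H] [CompleteSpace H]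

/-- Gelfand duality for a commuting family of normal operators. -/
theorem exists_starAlgHom_of_commute.{u, v} {H : Type u} [NormedAddCommGroup H]
    [InnerProductSpace ℂ H] [CompleteSpace H] {I : Type v} (R : I → H →L[ℂ] H)
    (hcomm : ∀ i j, Commute (R i) (R j)) (hstar : ∀ i j, Commute (R i) (star (R j))) :
    ∃ (Y : Type u) (_ : TopologicalSpace Y) (_ : CompactSpace Y) (_ : T2Space Y)
      (Ψ : C(Y, ℂ) →⋆ₐ[ℂ] (H →L[ℂ] H)) (r : I → C(Y, ℂ)),
      Function.Injective Ψ ∧ ∀ i, Ψ (r i) = R i := by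
  let S₀ : StarSubalgebra ℂ (H →L[ℂ] H) := StarAlgebra.adjoin ℂ (Set.range R)
  have hS₀ : IsMulCommutative S₀ := StarAlgebra.isMulCommutative_adjoin ℂ
    (by rintro _ ⟨i, rfl⟩ _ ⟨j, rfl⟩; exact hcomm i j)
    (by rintro _ ⟨i, rfl⟩ _ ⟨j, rfl⟩; exact hstar i j)
  let S := S₀.topologicalClosure
  have hS : IsClosed (S : Set (H →L[ℂ] H)) := S₀.isClosed_topologicalClosure
  let cs : CStarAlgebra S := StarSubalgebra.cstarAlgebra S
  let ccs : CommCStarAlgebra S :=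
    { cs with
      mul_comm := (S₀.commRingTopologicalClosure fun x y => mul_comm' x y).mul_comm }
  let G := gelfandStarTransform S
  have hmem : ∀ i, R i ∈ S := fun i =>
    S₀.le_topologicalClosure (StarAlgebra.subset_adjoin ℂ _ ⟨i, rfl⟩)
  refine ⟨WeakDual.characterSpace ℂ S, inferInstance, inferInstance, inferInstance,
    S.subtype.comp G.symm.toStarAlgHom, fun i => G ⟨R i, hmem i⟩, ?_, fun i => ?_⟩
  · exact Subtype.val_injective.comp G.symm.injective
  · exact congrArg Subtype.val (G.symm_apply_apply ⟨R i, hmem i⟩)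

/-- The spectral measure of a vector. -/
theorem exists_measure_integral_eq_inner {Y : Type*} [TopologicalSpace Y] [CompactSpace Y]
    [T2Space Y] [MeasurableSpace Y] [BorelSpace Y] (Ψ : C(Y, ℂ) →⋆ₐ[ℂ] (H →L[ℂ] H)) (Ω : H) :
    ∃ μ : Measure Y, IsFiniteMeasure μ ∧ μ.Regular ∧
      ∀ f : C(Y, ℂ), ∫ y, f y ∂μ = inner ℂ Ω (Ψ f Ω) := by
  let c : C(Y, ℝ) → C(Y, ℂ) := fun f => ⟨fun y => (f y : ℂ), by fun_prop⟩
  let Λ : CompactlySupportedContinuousMap Y ℝ →ₗ[ℝ] ℝ :=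
    { toFun := fun f => (inner ℂ Ω (Ψ (c f.toContinuousMap) Ω)).re
      map_add' := fun f g => by
        rw [show c (f + g).toContinuousMap = c f.toContinuousMap + c g.toContinuousMap by
          ext y; simp [c]]
        simp
      map_smul' := fun a f => by
        rw [show c (a • f).toContinuousMap = (a : ℂ) • c f.toContinuousMap by
          ext y; simp [c]]
        rw [map_smul, smul_apply, inner_smul_right]
        simp }
  have hΛ : ∀ f, 0 ≤ f → 0 ≤ Λ f := by
    intro f hf
    let h : C(Y, ℝ) := ⟨fun y => Real.sqrt (f y), by fun_prop⟩
    have h1 : c f.toContinuousMap = star (c h) * c h := by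
      ext y
      simp only [c, h, ContinuousMap.coe_mk, ContinuousMap.mul_apply, ContinuousMap.star_apply,
        RCLike.star_def, Complex.conj_ofReal]
      rw [← Complex.ofReal_mul, Real.mul_self_sqrt (hf y)]
      rfl
    change 0 ≤ (inner ℂ Ω (Ψ (c f.toContinuousMap) Ω)).re
    rw [h1, map_mul, map_star, ContinuousLinearMap.star_eq_adjoint, mul_apply_eq_comp,
      ContinuousLinearMap.adjoint_inner_right]
    exact inner_self_nonneg (𝕜 := ℂ)
  let Λp : CompactlySupportedContinuousMap Y ℝ →ₚ[ℝ] ℝ := PositiveLinearMap.mk₀ Λ hΛ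
  have : IsFiniteMeasureOnCompacts (RealRMK.rieszMeasure Λp) := inferInstance
  have hfin : IsFiniteMeasure (RealRMK.rieszMeasure Λp) := ⟨isCompact_univ.measure_lt_top⟩
  refine ⟨RealRMK.rieszMeasure Λp, hfin, inferInstance, fun f => ?_⟩
  have hreal : ∀ f : C(Y, ℝ), ((∫ y, f y ∂(RealRMK.rieszMeasure Λp) : ℝ) : ℂ) =
      inner ℂ Ω (Ψ (c f) Ω) := by
    intro f
    have h1 := RealRMK.integral_rieszMeasure Λp
      (CompactlySupportedContinuousMap.continuousMapEquiv f)
    have h2 : star (c f) = c f := by ext y; simp [c]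
    have h3 : (inner ℂ Ω (Ψ (c f) Ω)).im = 0 := by
      refine Complex.conj_eq_iff_im.1 ?_
      rw [inner_conj_symm, ← ContinuousLinearMap.adjoint_inner_right,
        ← ContinuousLinearMap.star_eq_adjoint, ← map_star, h2]
    rw [show (∫ y, f y ∂(RealRMK.rieszMeasure Λp)) = (inner ℂ Ω (Ψ (c f) Ω)).re from h1]
    apply Complex.ext <;> simp [h3]
  let fr : C(Y, ℝ) := ⟨fun y => (f y).re, by fun_prop⟩
  let fi : C(Y, ℝ) := ⟨fun y => (f y).im, by fun_prop⟩
  have hf : f = c fr + Complex.I • c fi := by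
    ext y
    simp [c, fr, fi, mul_comm Complex.I]
  have hint : Integrable (fun y => f y) (RealRMK.rieszMeasure Λp) :=
    f.continuous.integrable_of_hasCompactSupport (HasCompactSupport.of_compactSpace _)
  rw [← integral_re_add_im hint]
  conv_rhs => rw [hf]
  rw [map_add, map_smul, add_apply, smul_apply,
    inner_add_right, inner_smul_right, ← hreal, ← hreal, mul_comm]
  rfl

end Spectral

section ResolventIdentities

open scoped ComplexConjugate

variable {D H : Type*} [CommRing D] [Algebra ℂ D] [NormedAddCommGroup H]
  [InnerProductSpace ℂ H] {ι : D →ₗ[ℂ] H} {v : D} {R S : H →L[ℂ] H} {t : ℂ}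

theorem IsInverse.sub_star [CompleteSpace H] (hι : DenseRange ι) (hv : IsQuasiAnalytic ι v)
    (hR : IsInverse ι (v + algebraMap ℂ D Complex.I) R) :
    R - star R = (-(2 * Complex.I)) • (R * star R) := by
  have hR' := isInverse_star hv (by simp) hι hR
  refine ext_of_denseRange (hv.denseRange_mul hι hv (z := Complex.I) (z' := conj Complex.I)
    (by simp) (by simp)) fun x => ?_
  simp only [sub_apply, smul_apply, mul_apply_eq_comp]
  rw [mul_assoc, hR, mul_left_comm, hR', hR]
  simp only [Complex.conj_I, ← map_smul, ← map_sub, Algebra.smul_def, map_neg, map_mul, map_ofNat]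
  congr 1
  ring

theorem IsInverse.eq_mul [CompleteSpace H] (hι : DenseRange ι) (hv : IsQuasiAnalytic ι v)
    (htv : IsQuasiAnalytic ι (t • v))
    (hR : IsInverse ι (v + algebraMap ℂ D Complex.I) R)
    (hS : IsInverse ι (t • v + algebraMap ℂ D Complex.I) S) :
    R = S * (t • 1 + ((1 - t) * Complex.I) • R) := by
  refine ext_of_denseRange (hv.denseRange_mul hι htv (z := Complex.I) (z' := Complex.I)
    (by simp) (by simp)) fun x => ?_
  simp only [add_apply, smul_apply, mul_apply_eq_comp, one_apply_eq_self, map_add, map_smul]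
  rw [mul_assoc, hR, mul_left_comm, hS, hS]
  simp only [← map_smul, ← map_add, Algebra.smul_def, map_mul, map_sub, map_one]
  congr 1
  ring

theorem IsInverse.apply_mul (hS : IsInverse ι (t • v + algebraMap ℂ D Complex.I) S) (x : D) :
    t • S (ι (v * x)) = ι x - Complex.I • S (ι x) := by
  have h := hS x
  rw [add_mul, ← Algebra.smul_def, smul_mul_assoc] at h
  simp only [map_add, map_smul] at h
  exact eq_sub_of_add_eq h

theorem inv_eq_re_add_I {r : ℂ} (hr : r - conj r = -(2 * Complex.I) * (r * conj r))
    (h0 : r ≠ 0) : r⁻¹ = (r⁻¹).re + Complex.I := by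
  have hc : conj r ≠ 0 := by simpa using h0
  have h1 : r⁻¹ - conj r⁻¹ = 2 * Complex.I := by
    rw [map_inv₀]
    field_simp
    linear_combination -hr
  have h2 : (r⁻¹).im = 1 := by
    have := congrArg Complex.im h1
    rw [Complex.sub_im, Complex.conj_im] at this
    simp only [Complex.mul_im, Complex.re_ofNat, Complex.im_ofNat, Complex.I_re,
      Complex.I_im] at this
    linarith
  apply Complex.ext <;> simp [h2]

end ResolventIdentities

section ResolventModel

open scoped ComplexConjugate
open MeasureTheory Filter Topology

/-- Simultaneous diagonalization of the resolvents at `-i` of multiplication by the elements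
`j v`. -/
structure ResolventModel {D H W : Type*} [CommRing D] [Algebra ℂ D] [NormedAddCommGroup H]
    [InnerProductSpace ℂ H] [CompleteSpace H] [AddCommGroup W] [Module ℝ W] (ι : D →ₗ[ℂ] H)
    (j : W → D) (Y : Type*) [TopologicalSpace Y] [CompactSpace Y] where
  Ψ : C(Y, ℂ) →⋆ₐ[ℂ] (H →L[ℂ] H)
  r : W → C(Y, ℂ)
  isInverse : ∀ v, IsInverse ι (j v + algebraMap ℂ D Complex.I) (Ψ (r v))
  norm_le : ∀ v, ‖Ψ (r v)‖ ≤ 1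
  sub_conj : ∀ v y, r v y - conj (r v y) = -(2 * Complex.I) * (r v y * conj (r v y))
  eq_mul : ∀ (t : ℝ) v y, r v y = r (t • v) y * (t + (1 - t) * Complex.I * r v y)

theorem exists_resolventModel.{u} {H : Type u} {D W : Type*} [CommRing D] [Algebra ℂ D]
    [NormedAddCommGroup H] [InnerProductSpace ℂ H] [CompleteSpace H] [AddCommGroup W] [Module ℝ W]
    {ι : D →ₗ[ℂ] H} {j : W → D} (hj : ∀ (t : ℝ) v, j (t • v) = (t : ℂ) • j v)
    (hι : DenseRange ι) (hqa : ∀ v, IsQuasiAnalytic ι (j v)) :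
    ∃ (Y : Type u) (_ : TopologicalSpace Y) (_ : CompactSpace Y) (_ : T2Space Y),
      Nonempty (ResolventModel ι j Y) := by
  choose R hR hn using fun v => exists_isInverse hι (hqa v)
  have him : (conj Complex.I).im ≠ 0 := by simp
  obtain ⟨Y, _, _, _, Ψ, r, hΨ, hr⟩ := exists_starAlgHom_of_commute R
    (fun v w => (hR v).commute (hR w) ((hqa v).denseRange_mul hι (hqa w) (by simp) (by simp)))
    (fun v w => (hR v).commute (isInverse_star (hqa w) (by simp) hι (hR w))
      ((hqa v).denseRange_mul hι (hqa w) (by simp) him))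
  refine ⟨Y, _, ‹_›, ‹_›, ⟨⟨Ψ, r, fun v => by rw [hr]; exact hR v, fun v => by rw [hr]; exact hn v,
    fun v y => ?_, fun t v y => ?_⟩⟩⟩
  · have h : r v - star (r v) = (-(2 * Complex.I)) • (r v * star (r v)) := hΨ (by
      rw [map_sub, map_smul, map_mul, map_star, hr]
      exact (hR v).sub_star hι (hqa v))
    exact DFunLike.congr_fun h y
  · have h : r v = r (t • v) * ((t : ℂ) • 1 + ((1 - t) * Complex.I) • r v) := hΨ (by
      rw [map_mul, map_add, map_smul, map_smul, map_one, hr, hr]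
      refine (hR v).eq_mul hι (hqa v) (hj t v ▸ hqa _) ?_
      rw [← hj]
      exact hR _)
    have := DFunLike.congr_fun h y
    simpa using this

namespace ResolventModel

variable {D H W : Type*} [CommRing D] [Algebra ℂ D] [NormedAddCommGroup H]
  [InnerProductSpace ℂ H] [CompleteSpace H] [AddCommGroup W] [Module ℝ W] {ι : D →ₗ[ℂ] H}
  {j : W → D} {Y : Type*} [TopologicalSpace Y] [CompactSpace Y]
  (M : ResolventModel ι j Y)

/-- The real coordinate `x` recovered from the resolvent `1 / (x + i)`. -/
noncomputable def coord (v : W) (y : Y) : ℝ := ((M.r v y)⁻¹).re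

/-- The approximation `i / (t x + i)` of the constant function `1`. -/
noncomputable def unitApprox (t : ℝ) (v : W) : C(Y, ℂ) := Complex.I • M.r (t • v)

/-- The approximation `i x / (t x + i)` of the coordinate `x`. -/
noncomputable def coordApprox (t : ℝ) (v : W) : C(Y, ℂ) :=
  (Complex.I / t) • (1 - M.unitApprox t v)

variable {M} {t : ℝ} {v : W} {y : Y}

theorem inv_eq (h : M.r v y ≠ 0) : (M.r v y)⁻¹ = M.coord v y + Complex.I :=
  inv_eq_re_add_I (M.sub_conj v y) h

theorem coord_add_I_ne_zero (x : ℝ) : (x : ℂ) + Complex.I ≠ 0 := fun h => by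
  simpa using congrArg Complex.im h

theorem one_le_norm_add_I (x : ℝ) : 1 ≤ ‖(x : ℂ) + Complex.I‖ := by
  have := Complex.abs_im_le_norm ((x : ℂ) + Complex.I)
  simpa using this

theorem unitApprox_eq (h : M.r v y ≠ 0) :
    M.unitApprox t v y = Complex.I / ((t * M.coord v y : ℝ) + Complex.I) := by
  have h1 := M.eq_mul t v y
  have h2 := inv_eq h
  have h3 : M.r v y = (M.coord v y + Complex.I)⁻¹ := by rw [← h2, inv_inv]
  have h4 := coord_add_I_ne_zero (M.coord v y)
  have h5 := coord_add_I_ne_zero (t * M.coord v y)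
  rw [h3] at h1
  simp only [unitApprox, ContinuousMap.smul_apply, smul_eq_mul]
  push_cast at h5 ⊢
  rw [eq_div_iff h5]
  field_simp at h1
  linear_combination -Complex.I * h1

theorem unitApprox_eq_zero (ht : t ≠ 0) (h : M.r v y = 0) : M.unitApprox t v y = 0 := by
  have h1 := M.eq_mul t v y
  rw [h, mul_zero, add_zero] at h1
  have : M.r (t • v) y = 0 := by simpa [ht] using h1.symm
  simp [unitApprox, this]

theorem coordApprox_eq (ht : t ≠ 0) (h : M.r v y ≠ 0) :
    M.coordApprox t v y = M.coord v y * M.unitApprox t v y := by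
  have h5 := coord_add_I_ne_zero (t * M.coord v y)
  have ht' : (t : ℂ) ≠ 0 := by exact_mod_cast ht
  simp only [coordApprox, ContinuousMap.smul_apply, ContinuousMap.sub_apply,
    ContinuousMap.one_apply, unitApprox_eq h, smul_eq_mul]
  push_cast at h5 ⊢
  field_simp
  ring

theorem norm_unitApprox_le (h : M.r v y ≠ 0) : ‖M.unitApprox t v y‖ ≤ 1 := by
  rw [unitApprox_eq h, norm_div, Complex.norm_I]
  exact div_le_one_of_le₀ (one_le_norm_add_I _) (norm_nonneg _)

theorem norm_coordApprox_le (ht : t ≠ 0) (h : M.r v y ≠ 0) :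
    ‖M.coordApprox t v y‖ ≤ ‖(M.coord v y : ℂ)‖ := by
  rw [coordApprox_eq ht h, norm_mul]
  exact mul_le_of_le_one_right (norm_nonneg _) (norm_unitApprox_le h)

theorem tendsto_coordApprox (h : M.r v y ≠ 0) :
    Tendsto (fun n : ℕ => M.coordApprox (1 / ((n : ℝ) + 1)) v y) atTop (𝓝 (M.coord v y : ℂ)) := by
  have h1 : Tendsto (fun n : ℕ => M.coord v y * (Complex.I /
      ((1 / ((n : ℝ) + 1) * M.coord v y : ℝ) + Complex.I))) atTop
      (𝓝 (M.coord v y * (Complex.I / ((0 * M.coord v y : ℝ) + Complex.I)))) := by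
    refine (tendsto_const_nhds.div ?_ (by simp)).const_mul _
    refine Tendsto.add_const _ ?_
    exact (Complex.continuous_ofReal.tendsto _).comp
      ((tendsto_one_div_add_atTop_nhds_zero_nat (𝕜 := ℝ)).mul_const _)
  have h2 : M.coord v y * (Complex.I / ((0 * M.coord v y : ℝ) + Complex.I)) =
      (M.coord v y : ℂ) := by
    simp
  rw [h2] at h1
  refine h1.congr fun n => ?_
  rw [coordApprox_eq (by positivity) h, unitApprox_eq h]

theorem norm_apply_unitApprox_le (x : H) : ‖M.Ψ (M.unitApprox t v) x‖ ≤ ‖x‖ := by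
  simp only [unitApprox, map_smul, smul_apply, norm_smul, Complex.norm_I, one_mul]
  exact ((M.Ψ _).le_opNorm x).trans (mul_le_of_le_one_left (norm_nonneg _) (M.norm_le _))

theorem apply_unitApprox_mul (hj : ∀ (t : ℝ) v, j (t • v) = (t : ℂ) • j v) (x : D) :
    (t : ℂ) • M.Ψ (M.unitApprox t v) (ι (j v * x)) =
      Complex.I • (ι x - M.Ψ (M.unitApprox t v) (ι x)) := by
  have h := M.isInverse (t • v)
  rw [hj] at h
  have := h.apply_mul x
  simp only [unitApprox, map_smul, smul_apply]
  rw [smul_comm, this]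

theorem norm_apply_unitApprox_sub_le (hj : ∀ (t : ℝ) v, j (t • v) = (t : ℂ) • j v) (ht : 0 ≤ t)
    (x : D) : ‖ι x - M.Ψ (M.unitApprox t v) (ι x)‖ ≤ t * ‖ι (j v * x)‖ := by
  have h := congrArg norm (apply_unitApprox_mul (M := M) (t := t) (v := v) hj x)
  rw [norm_smul, norm_smul, Complex.norm_I, one_mul, Complex.norm_real, Real.norm_of_nonneg ht] at h
  rw [← h]
  exact mul_le_mul_of_nonneg_left (norm_apply_unitApprox_le _) ht

theorem apply_coordApprox (hj : ∀ (t : ℝ) v, j (t • v) = (t : ℂ) • j v) (ht : t ≠ 0) (x : D) :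
    M.Ψ (M.coordApprox t v) (ι x) = M.Ψ (M.unitApprox t v) (ι (j v * x)) := by
  have ht' : (t : ℂ) ≠ 0 := by exact_mod_cast ht
  have h := apply_unitApprox_mul (M := M) (t := t) (v := v) hj x
  rw [← smul_right_inj ht', h, coordApprox, map_smul, map_sub, map_one, smul_apply, sub_apply,
    one_apply_eq_self, smul_smul, mul_div_cancel₀ _ ht']

/-- Products of `coordApprox`. -/
noncomputable def coordApproxProd (M : ResolventModel ι j Y) (t : ℝ) (l : List W) : C(Y, ℂ) :=
  (l.map (M.coordApprox t)).prod

/-- Products of `unitApprox`. -/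
noncomputable def unitApproxProd (M : ResolventModel ι j Y) (t : ℝ) (l : List W) : C(Y, ℂ) :=
  (l.map (M.unitApprox t)).prod

theorem apply_coordApproxProd (hj : ∀ (t : ℝ) v, j (t • v) = (t : ℂ) • j v) (ht : t ≠ 0)
    (l : List W) (x : D) : M.Ψ (M.coordApproxProd t l) (ι x) =
      M.Ψ (M.unitApproxProd t l) (ι ((l.map j).prod * x)) := by
  induction l generalizing x with
  | nil => simp [coordApproxProd, unitApproxProd]
  | cons v l ih =>
    have hc : ∀ (f g : C(Y, ℂ)) z, M.Ψ f (M.Ψ g z) = M.Ψ g (M.Ψ f z) := fun f g z => by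
      rw [← mul_apply_eq_comp, ← map_mul, mul_comm, map_mul, mul_apply_eq_comp]
    have h1 : M.coordApproxProd t (v :: l) = M.coordApprox t v * M.coordApproxProd t l := by
      simp [coordApproxProd]
    have h2 : M.unitApproxProd t (v :: l) = M.unitApprox t v * M.unitApproxProd t l := by
      simp [unitApproxProd]
    rw [h1, h2, map_mul, map_mul, mul_apply_eq_comp, mul_apply_eq_comp, ih, hc,
      apply_coordApprox hj ht, hc, List.map_cons, List.prod_cons, mul_assoc]

theorem norm_apply_unitApproxProd_le (l : List W) (x : H) :
    ‖M.Ψ (M.unitApproxProd t l) x‖ ≤ ‖x‖ := by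
  induction l with
  | nil => simp [unitApproxProd]
  | cons v l ih =>
    rw [unitApproxProd, List.map_cons, List.prod_cons, map_mul, mul_apply_eq_comp]
    exact (norm_apply_unitApprox_le _).trans ih

theorem tendsto_apply_unitApproxProd (hj : ∀ (t : ℝ) v, j (t • v) = (t : ℂ) • j v)
    (l : List W) (x : D) :
    Tendsto (fun n : ℕ => M.Ψ (M.unitApproxProd (1 / ((n : ℝ) + 1)) l) (ι x)) atTop
      (𝓝 (ι x)) := by
  suffices h : ∃ K, ∀ t, 0 ≤ t → ‖ι x - M.Ψ (M.unitApproxProd t l) (ι x)‖ ≤ t * K by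
    obtain ⟨K, hK⟩ := h
    rw [tendsto_iff_norm_sub_tendsto_zero]
    refine squeeze_zero (g := fun n : ℕ => 1 / ((n : ℝ) + 1) * K) (fun n => norm_nonneg _)
      (fun n => by rw [norm_sub_rev]; exact hK _ (by positivity)) ?_
    simpa using (tendsto_one_div_add_atTop_nhds_zero_nat (𝕜 := ℝ)).mul_const K
  induction l with
  | nil => exact ⟨0, fun t _ => by simp [unitApproxProd]⟩
  | cons v l ih =>
    obtain ⟨K, hK⟩ := ih
    refine ⟨‖ι (j v * x)‖ + K, fun t ht => ?_⟩
    have h : ι x - M.Ψ (M.unitApproxProd t (v :: l)) (ι x) =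
        (ι x - M.Ψ (M.unitApprox t v) (ι x)) +
          M.Ψ (M.unitApprox t v) (ι x - M.Ψ (M.unitApproxProd t l) (ι x)) := by
      rw [map_sub]
      simp [unitApproxProd]
    rw [h, mul_add]
    exact (norm_add_le _ _).trans (add_le_add (norm_apply_unitApprox_sub_le hj ht x)
      ((norm_apply_unitApprox_le _).trans (hK t ht)))

theorem tendsto_coordApproxProd {l : List W} {y : Y} (h : ∀ v ∈ l, M.r v y ≠ 0) :
    Tendsto (fun n : ℕ => M.coordApproxProd (1 / ((n : ℝ) + 1)) l y) atTop
      (𝓝 (((l.map (M.coord · y)).prod : ℝ) : ℂ)) := by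
  induction l with
  | nil => simp [coordApproxProd]
  | cons v l ih =>
    simp only [List.forall_mem_cons] at h
    have := (tendsto_coordApprox h.1).mul (ih h.2)
    simpa [coordApproxProd] using this

theorem norm_coordApproxProd_le {l : List W} {y : Y} {t : ℝ} (ht : t ≠ 0)
    (h : ∀ v ∈ l, M.r v y ≠ 0) :
    ‖M.coordApproxProd t l y‖ ≤ ‖(((l.map (M.coord · y)).prod : ℝ) : ℂ)‖ := by
  induction l with
  | nil => simp [coordApproxProd]
  | cons v l ih =>
    simp only [List.forall_mem_cons] at h
    simp only [coordApproxProd, List.map_cons, List.prod_cons, ContinuousMap.mul_apply, norm_mul,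
      Complex.ofReal_mul]
    exact mul_le_mul (norm_coordApprox_le ht h.1) (ih h.2) (norm_nonneg _) (norm_nonneg _)

end ResolventModel

end ResolventModel

namespace ResolventModel

open scoped ComplexConjugate ENNReal
open MeasureTheory Filter Topology

variable {D H W : Type*} [CommRing D] [Algebra ℂ D] [NormedAddCommGroup H]
  [InnerProductSpace ℂ H] [CompleteSpace H] [AddCommGroup W] [Module ℝ W] {ι : D →ₗ[ℂ] H}
  {j : W → D} {Y : Type*} [TopologicalSpace Y] [CompactSpace Y] [MeasurableSpace Y] [BorelSpace Y]
  {M : ResolventModel ι j Y} {μ : Measure Y} [IsFiniteMeasure μ]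

theorem lintegral_enorm_sq {Ω : H} (hμ : ∀ f : C(Y, ℂ), ∫ y, f y ∂μ = inner ℂ Ω (M.Ψ f Ω))
    (f : C(Y, ℂ)) : ∫⁻ y, ‖f y‖ₑ ^ 2 ∂μ = ENNReal.ofReal (‖M.Ψ f Ω‖ ^ 2) := by
  have h1 : ((∫ y, ‖f y‖ ^ 2 ∂μ : ℝ) : ℂ) = ((‖M.Ψ f Ω‖ ^ 2 : ℝ) : ℂ) := by
    have h2 := hμ (star f * f)
    rw [map_mul, map_star, mul_apply_eq_comp, ContinuousLinearMap.star_eq_adjoint,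
      ContinuousLinearMap.adjoint_inner_right, inner_self_eq_norm_sq_to_K] at h2
    rw [← integral_complex_ofReal]
    push_cast
    refine Eq.trans (integral_congr_ae (ae_of_all _ fun y => ?_)) h2
    simp [Complex.conj_mul']
  have h3 : ∫ y, ‖f y‖ ^ 2 ∂μ = ‖M.Ψ f Ω‖ ^ 2 := by exact_mod_cast h1
  have hint : Integrable (fun y => ‖f y‖ ^ 2) μ :=
    (f.continuous.norm.pow 2).integrable_of_hasCompactSupport (HasCompactSupport.of_compactSpace _)
  rw [← h3, ofReal_integral_eq_lintegral_ofReal hint (ae_of_all _ fun y => by positivity)]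
  refine lintegral_congr fun y => ?_
  rw [ENNReal.ofReal_pow (norm_nonneg _), ofReal_norm]

theorem ae_r_ne_zero (hj : ∀ (t : ℝ) v, j (t • v) = (t : ℂ) • j v)
    (hμ : ∀ f : C(Y, ℂ), ∫ y, f y ∂μ = inner ℂ (ι 1) (M.Ψ f (ι 1))) (v : W) :
    ∀ᵐ y ∂μ, M.r v y ≠ 0 := by
  have hle : ∀ n : ℕ, μ {y | M.r v y = 0} ≤
      ENNReal.ofReal ((1 / ((n : ℝ) + 1) * ‖ι (j v * 1)‖) ^ 2) := by
    intro n
    set t : ℝ := 1 / ((n : ℝ) + 1)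
    have ht : 0 < t := by positivity
    calc μ {y | M.r v y = 0} = ∫⁻ y in {y | M.r v y = 0}, 1 ∂μ := by simp
      _ ≤ ∫⁻ y in {y | M.r v y = 0}, ‖(1 - M.unitApprox t v) y‖ₑ ^ 2 ∂μ := by
        refine setLIntegral_mono' (measurableSet_eq_fun (M.r v).continuous.measurable
          measurable_const) fun y hy => ?_
        rw [ContinuousMap.sub_apply, unitApprox_eq_zero ht.ne' hy]
        simp
      _ ≤ ∫⁻ y, ‖(1 - M.unitApprox t v) y‖ₑ ^ 2 ∂μ := setLIntegral_le_lintegral _ _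
      _ = ENNReal.ofReal (‖M.Ψ (1 - M.unitApprox t v) (ι 1)‖ ^ 2) := lintegral_enorm_sq hμ _
      _ ≤ _ := by
        refine ENNReal.ofReal_le_ofReal (pow_le_pow_left₀ (norm_nonneg _) ?_ 2)
        rw [map_sub, map_one, sub_apply, one_apply_eq_self]
        exact norm_apply_unitApprox_sub_le hj ht.le 1
  have hlim : Tendsto (fun n : ℕ => ENNReal.ofReal ((1 / ((n : ℝ) + 1) * ‖ι (j v * 1)‖) ^ 2))
      atTop (𝓝 0) := by
    rw [← ENNReal.ofReal_zero]
    refine ENNReal.tendsto_ofReal ?_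
    simpa using ((tendsto_one_div_add_atTop_nhds_zero_nat (𝕜 := ℝ)).mul_const
      ‖ι (j v * 1)‖).pow 2
  rw [ae_iff]
  simpa using ge_of_tendsto' hlim hle

theorem measurable_coord (v : W) : Measurable (M.coord v) :=
  Complex.measurable_re.comp (M.r v).continuous.measurable.inv

/-- The moments of the spectral measure of `ι 1`. -/
theorem integrable_and_integral_prod (hj : ∀ (t : ℝ) v, j (t • v) = (t : ℂ) • j v)
    (hμ : ∀ f : C(Y, ℂ), ∫ y, f y ∂μ = inner ℂ (ι 1) (M.Ψ f (ι 1))) (l : List W) :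
    Integrable (fun y => (l.map (M.coord · y)).prod) μ ∧
      ((∫ y, (l.map (M.coord · y)).prod ∂μ : ℝ) : ℂ) = inner ℂ (ι 1) (ι (l.map j).prod) := by
  have hae : ∀ᵐ y ∂μ, ∀ v ∈ l, M.r v y ≠ 0 := by
    induction l with
    | nil => simp
    | cons v l ih =>
      filter_upwards [ih, ae_r_ne_zero hj hμ v] with y h1 h2
      simpa only [List.forall_mem_cons] using ⟨h2, h1⟩
  have hmeas : Measurable fun y => (l.map (M.coord · y)).prod := by
    clear hae
    induction l with
    | nil => simp
    | cons v l ih => exact (measurable_coord v).mul ih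
  have hfatou : ∫⁻ y, ‖(((l.map (M.coord · y)).prod : ℝ) : ℂ)‖ₑ ^ 2 ∂μ ≤
      ENNReal.ofReal (‖ι (l.map j).prod‖ ^ 2) := by
    calc ∫⁻ y, ‖(((l.map (M.coord · y)).prod : ℝ) : ℂ)‖ₑ ^ 2 ∂μ
        ≤ ∫⁻ y, liminf (fun n : ℕ =>
          ‖M.coordApproxProd (1 / ((n : ℝ) + 1)) l y‖ₑ ^ 2) atTop ∂μ := by
          refine lintegral_mono_ae ?_
          filter_upwards [hae] with y hy
          exact (((ENNReal.continuous_pow 2).tendsto _).comp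
            (tendsto_coordApproxProd hy).enorm).liminf_eq.ge
      _ ≤ liminf (fun n : ℕ => ∫⁻ y, ‖M.coordApproxProd (1 / ((n : ℝ) + 1)) l y‖ₑ ^ 2 ∂μ) atTop :=
          lintegral_liminf_le fun n => (ContinuousMap.continuous _).measurable.enorm.pow_const 2
      _ ≤ liminf (fun _ : ℕ => ENNReal.ofReal (‖ι (l.map j).prod‖ ^ 2)) atTop := by
          refine liminf_le_liminf (Eventually.of_forall fun n => ?_)
          rw [lintegral_enorm_sq hμ, apply_coordApproxProd hj (by positivity), mul_one]
          exact ENNReal.ofReal_le_ofReal (pow_le_pow_left₀ (norm_nonneg _)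
            (norm_apply_unitApproxProd_le _ _) 2)
      _ = _ := liminf_const _
  have hmem : MemLp (fun y => (l.map (M.coord · y)).prod) 2 μ := by
    refine ⟨hmeas.aestronglyMeasurable, ?_⟩
    rw [eLpNorm_lt_top_iff_lintegral_rpow_enorm_lt_top two_ne_zero ENNReal.ofNat_ne_top]
    refine lt_of_le_of_lt ?_ (hfatou.trans_lt ENNReal.ofReal_lt_top)
    refine lintegral_mono fun y => ?_
    simp only [ENNReal.toReal_ofNat]
    rw [← ENNReal.rpow_natCast, ← ofReal_norm, ← ofReal_norm, Complex.norm_real]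
    rfl
  have hint := hmem.integrable one_le_two
  refine ⟨hint, ?_⟩
  have h1 : Tendsto (fun n : ℕ => ∫ y, M.coordApproxProd (1 / ((n : ℝ) + 1)) l y ∂μ) atTop
      (𝓝 (∫ y, (((l.map (M.coord · y)).prod : ℝ) : ℂ) ∂μ)) := by
    refine tendsto_integral_of_dominated_convergence
      (fun y => ‖(((l.map (M.coord · y)).prod : ℝ) : ℂ)‖)
      (fun n => (ContinuousMap.continuous _).aestronglyMeasurable) hint.ofReal.norm
      (fun n => ?_) ?_
    · filter_upwards [hae] with y hy
      exact norm_coordApproxProd_le (by positivity) hy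
    · filter_upwards [hae] with y hy
      exact tendsto_coordApproxProd hy
  have h2 : Tendsto (fun n : ℕ => ∫ y, M.coordApproxProd (1 / ((n : ℝ) + 1)) l y ∂μ) atTop
      (𝓝 (inner ℂ (ι 1) (ι (l.map j).prod))) := by
    have := (tendsto_const_nhds (x := ι 1)).inner (𝕜 := ℂ)
      (tendsto_apply_unitApproxProd (M := M) hj l ((l.map j).prod))
    refine this.congr fun n => ?_
    rw [hμ, apply_coordApproxProd hj (by positivity), mul_one]
  rw [← integral_complex_ofReal]
  exact tendsto_nhds_unique h1 h2

end ResolventModel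

section MomentModel

open scoped TensorProduct ComplexConjugate

variable {A : Type*} [CommRing A] [Algebra ℝ A] {L : A →ₗ[ℝ] ℝ}

theorem sq_apply_mul_le (hL : ∀ a, 0 ≤ L (a * a)) (a b : A) :
    L (a * b) ^ 2 ≤ L (a * a) * L (b * b) := by
  have h : ∀ t : ℝ, 0 ≤ L (b * b) * (t * t) + 2 * L (a * b) * t + L (a * a) := by
    intro t
    have h1 := hL (a + t • b)
    have h2 : (a + t • b) * (a + t • b) = a * a + (2 * t) • (a * b) + (t * t) • (b * b) := by
      simp only [Algebra.smul_def, map_mul, map_ofNat]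
      ring
    rw [h2] at h1
    simp only [map_add, map_smul, smul_eq_mul] at h1
    linarith
  have := discrim_le_zero h
  rw [discrim] at this
  nlinarith

/-- A Carleman condition for the moments of `v` controls the growth of all the sequences
`L (v ^ (2 * n) * c)`. -/
theorem exists_carleman_bound (hL1 : L 1 = 1) (hL : ∀ a, 0 ≤ L (a * a)) {v : A}
    (hv : ∑' n : ℕ, (ENNReal.ofReal ((L (v ^ (2 * (n + 1)))) ^
      ((1 : ℝ) / (2 * (n + 1) : ℝ))))⁻¹ = ⊤) :
    ∃ u : ℕ → ℝ, (∀ n, 0 ≤ u n) ∧ ¬ Summable u ∧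
      ∀ c n, L (v ^ (2 * (n + 1)) * c) * u n ^ (2 * (n + 1)) ≤ √(L (c * c)) := by
  obtain ⟨u, hu, hns, h⟩ := exists_not_summable_of_carleman (m := fun k => L (v ^ (2 * k)))
    (fun k => by rw [two_mul, pow_add]; exact hL _) (by simpa using hL1)
    (fun k => by
      convert sq_apply_mul_le hL (v ^ k) (v ^ (k + 2)) using 3 <;> ring_nf) hv
  refine ⟨u, hu, hns, fun c n => Real.le_sqrt_of_sq_le ?_⟩
  have h1 := sq_apply_mul_le hL (v ^ (2 * (n + 1))) c
  calc (L (v ^ (2 * (n + 1)) * c) * u n ^ (2 * (n + 1))) ^ 2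
      = L (v ^ (2 * (n + 1)) * c) ^ 2 * u n ^ (4 * (n + 1)) := by ring
    _ ≤ (L (v ^ (2 * (n + 1)) * v ^ (2 * (n + 1))) * L (c * c)) * u n ^ (4 * (n + 1)) :=
        mul_le_mul_of_nonneg_right h1 (pow_nonneg (hu n) _)
    _ = (L (v ^ (2 * (2 * (n + 1)))) * u n ^ (4 * (n + 1))) * L (c * c) := by ring_nf
    _ ≤ L (c * c) := mul_le_of_le_one_left (hL c) (h n)

theorem isQuasiAnalytic_of_carleman {H : Type*} [NormedAddCommGroup H] [InnerProductSpace ℂ H]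
    {ι : (ℂ ⊗[ℝ] A) →ₗ[ℂ] H}
    (hι : ∀ x y, inner ℂ (ι x) (ι y) = complexifyFunctional L (conjTensor A x * y))
    (hL1 : L 1 = 1) (hL : ∀ a, 0 ≤ L (a * a)) {v : A}
    (hv : ∑' n : ℕ, (ENNReal.ofReal ((L (v ^ (2 * (n + 1)))) ^
      ((1 : ℝ) / (2 * (n + 1) : ℝ))))⁻¹ = ⊤) :
    IsQuasiAnalytic ι ((1 : ℂ) ⊗ₜ[ℝ] v) where
  symm x y := by
    rw [hι, hι, map_mul (conjTensor A), conjTensor_tmul, map_one, mul_left_comm, mul_assoc]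
  carleman x := by
    obtain ⟨u, hu, hns, h⟩ := exists_carleman_bound hL1 hL hv
    obtain ⟨a, b, rfl⟩ := exists_eq_tmul_add_tmul x
    refine ⟨u, hu, hns, √(√(L (a * a * (a * a))) + √(L (b * b * (b * b)))), fun n => ?_⟩
    refine Real.le_sqrt_of_sq_le ?_
    have h1 : ((1 : ℂ) ⊗ₜ[ℝ] v) ^ (n + 1) * ((1 : ℂ) ⊗ₜ[ℝ] a + Complex.I ⊗ₜ[ℝ] b) =
        (1 : ℂ) ⊗ₜ[ℝ] (v ^ (n + 1) * a) + Complex.I ⊗ₜ[ℝ] (v ^ (n + 1) * b) := by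
      simp [Algebra.TensorProduct.tmul_pow, mul_add]
    have h2 : ‖ι (((1 : ℂ) ⊗ₜ[ℝ] v) ^ (n + 1) * ((1 : ℂ) ⊗ₜ[ℝ] a + Complex.I ⊗ₜ[ℝ] b))‖ ^ 2 =
        L (v ^ (2 * (n + 1)) * (a * a)) + L (v ^ (2 * (n + 1)) * (b * b)) := by
      have h3 := complexifyFunctional_conj_mul_self L (v ^ (n + 1) * a) (v ^ (n + 1) * b)
      rw [← hι] at h3
      replace h3 := congrArg RCLike.re h3
      rw [inner_self_eq_norm_sq] at h3
      have h4 : ∀ c, v ^ (n + 1) * c * (v ^ (n + 1) * c) = v ^ (2 * (n + 1)) * (c * c) :=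
        fun c => by ring
      rw [h1, ← h4, ← h4]
      exact h3
    rw [mul_pow, h2, ← pow_mul, mul_comm (n + 1) 2, add_mul]
    exact add_le_add (h _ n) (h _ n)

/-- A functional satisfying the Carleman conditions is represented by a measure on a compact space
on which the generators are almost everywhere defined functions. -/
theorem exists_moment_model.{u} {A : Type u} [CommRing A] [Algebra ℝ A] {L : A →ₗ[ℝ] ℝ}
    (V : Submodule ℝ A) (hL1 : L 1 = 1) (hL : ∀ a, 0 ≤ L (a * a))
    (hb : ∀ v : V, ∑' n : ℕ, (ENNReal.ofReal ((L ((v : A) ^ (2 * (n + 1)))) ^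
      ((1 : ℝ) / (2 * (n + 1) : ℝ))))⁻¹ = ⊤) :
    ∃ (Y : Type u) (_ : TopologicalSpace Y) (_ : CompactSpace Y) (_ : T2Space Y)
      (_ : MeasurableSpace Y) (_ : BorelSpace Y) (μ : Measure Y) (_ : IsFiniteMeasure μ)
      (_ : μ.Regular) (r : V → C(Y, ℂ)) (x : V → Y → ℝ),
      (∀ v y, r v y ≠ 0 → (r v y)⁻¹ = x v y + Complex.I) ∧ (∀ v, Measurable (x v)) ∧
      (∀ v, ∀ᵐ y ∂μ, r v y ≠ 0) ∧
      ∀ P : MvPolynomial V ℝ, Integrable (fun y => MvPolynomial.eval (x · y) P) μ ∧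
        ∫ y, MvPolynomial.eval (x · y) P ∂μ = L (MvPolynomial.aeval (fun v : V => (v : A)) P) := by
  obtain ⟨H, _, _, _, ι, hd, hι⟩ := exists_gns L hL
  let j : V → ℂ ⊗[ℝ] A := fun v => (1 : ℂ) ⊗ₜ[ℝ] (v : A)
  have hj : ∀ (t : ℝ) v, j (t • v) = (t : ℂ) • j v := fun t v => by
    simp [j, TensorProduct.smul_tmul']
  obtain ⟨Y, _, _, _, ⟨M⟩⟩ := exists_resolventModel hj hd
    fun v => isQuasiAnalytic_of_carleman hι hL1 hL (hb v)
  borelize Y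
  obtain ⟨μ, _, _, hμ⟩ := exists_measure_integral_eq_inner M.Ψ (ι 1)
  refine ⟨Y, _, ‹_›, ‹_›, _, ‹_›, μ, ‹_›, ‹_›, M.r, M.coord, fun v y => M.inv_eq,
    M.measurable_coord, M.ae_r_ne_zero hj hμ, fun P => ?_⟩
  have hprod : ∀ l : List V, (l.map j).prod =
      (1 : ℂ) ⊗ₜ[ℝ] (l.map (fun v : V => (v : A))).prod := by
    intro l
    induction l with
    | nil => rfl
    | cons v l ih =>
      rw [List.map_cons, List.prod_cons, ih, List.map_cons, List.prod_cons]
      simp [j]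
  have hlist : ∀ l : List V, Integrable (fun y => (l.map (M.coord · y)).prod) μ ∧
      ∫ y, (l.map (M.coord · y)).prod ∂μ = L (l.map (fun v : V => (v : A))).prod := fun l => by
    obtain ⟨h1, h2⟩ := M.integrable_and_integral_prod hj hμ l
    refine ⟨h1, ?_⟩
    rw [hι, hprod] at h2
    simpa using h2
  suffices h : ∀ l : List V,
      Integrable (fun y => MvPolynomial.eval (M.coord · y) P * (l.map (M.coord · y)).prod) μ ∧
      ∫ y, MvPolynomial.eval (M.coord · y) P * (l.map (M.coord · y)).prod ∂μ =
        L (MvPolynomial.aeval (fun v : V => (v : A)) P * (l.map (fun v : V => (v : A))).prod) by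
    simpa using h []
  induction P using MvPolynomial.induction_on with
  | C a =>
    intro l
    simp only [MvPolynomial.eval_C, MvPolynomial.aeval_C]
    refine ⟨(hlist l).1.const_mul a, ?_⟩
    rw [integral_const_mul, (hlist l).2, ← Algebra.smul_def, map_smul, smul_eq_mul]
  | add P P' h h' =>
    intro l
    simp only [map_add, add_mul]
    exact ⟨(h l).1.add (h' l).1, by rw [integral_add (h l).1 (h' l).1, (h l).2, (h' l).2]⟩
  | mul_X P v h =>
    intro l
    simpa [mul_assoc] using h (v :: l)

end MomentModel

section Trace

namespace HilbSeminorm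

variable {V : Type*} [AddCommGroup V] [Module ℝ V]

theorem toFun_sq (p : HilbSeminorm V) (v : V) : p.toFun v ^ 2 = p.bilin v v :=
  Real.sq_sqrt (p.nonneg v)

theorem toFun_nonneg (p : HilbSeminorm V) (v : V) : 0 ≤ p.toFun v := Real.sqrt_nonneg _

/-- Gram–Schmidt orthonormalization modulo the kernel of a Hilbertian seminorm. -/
theorem exists_isONS (q : HilbSeminorm V) (F : Finset V) :
    ∃ E : Finset V, q.IsONS E ∧ ∀ v ∈ F, ∃ c : V → ℝ,
      q.bilin (v - ∑ e ∈ E, c e • e) (v - ∑ e ∈ E, c e • e) = 0 ∧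
      ∑ e ∈ E, c e ^ 2 ≤ q.bilin v v := by
  classical
  induction F using Finset.induction_on with
  | empty => exact ⟨∅, ⟨by simp, by simp⟩, by simp⟩
  | insert v F _ ih =>
    obtain ⟨E, ⟨hE1, hE2⟩, hE⟩ := ih
    set k := v - ∑ e ∈ E, q.bilin v e • e with hk
    have hke : ∀ e ∈ E, q.bilin k e = 0 := fun e he => by
      simp only [hk, map_sub, map_sum, map_smul, LinearMap.sub_apply, LinearMap.sum_apply,
        LinearMap.smul_apply, smul_eq_mul]
      rw [Finset.sum_eq_single_of_mem e he fun f hf hfe => by rw [hE2 f hf e he hfe, mul_zero],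
        hE1 e he, mul_one, sub_self]
    have hvv : q.bilin v v = ∑ e ∈ E, q.bilin v e ^ 2 + q.bilin k k := by
      have h1 : q.bilin k k = q.bilin k v := by
        conv_lhs => rw [hk]
        rw [map_sub, map_sum, ← hk, Finset.sum_eq_zero fun e he => by
          rw [map_smul, hke e he, smul_zero], sub_zero]
      rw [h1, hk]
      simp only [map_sub, map_sum, map_smul, LinearMap.sub_apply, LinearMap.sum_apply,
        LinearMap.smul_apply, smul_eq_mul, q.symm _ v, sq, add_sub_cancel]
    by_cases h0 : q.bilin k k = 0
    · refine ⟨E, ⟨hE1, hE2⟩, Finset.forall_mem_insert _ _ _ |>.2 ⟨⟨q.bilin v, h0, ?_⟩, hE⟩⟩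
      rw [hvv, h0, add_zero]
    set t := √(q.bilin k k) with ht
    have htt : t * t = q.bilin k k := Real.mul_self_sqrt (q.nonneg k)
    have ht0 : t ≠ 0 := fun h => h0 (by rw [← htt, h, zero_mul])
    have he' : ∀ e ∈ E, q.bilin (t⁻¹ • k) e = 0 := fun e he => by
      rw [map_smul, LinearMap.smul_apply, hke e he, smul_zero]
    have hnot : t⁻¹ • k ∉ E := fun h => one_ne_zero ((hE1 _ h).symm.trans (he' _ h))
    have hupd : ∀ (c : V → ℝ) (s : ℝ) (f : V → ℝ → V),
        ∑ e ∈ E, f e (Function.update c (t⁻¹ • k) s e) = ∑ e ∈ E, f e (c e) := fun c s f =>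
      Finset.sum_congr rfl fun e he => by
        rw [Function.update_of_ne (fun h => hnot (by rwa [← h]))]
    have hupd' : ∀ (c : V → ℝ) (s : ℝ),
        ∑ e ∈ E, Function.update c (t⁻¹ • k) s e ^ 2 = ∑ e ∈ E, c e ^ 2 := fun c s =>
      Finset.sum_congr rfl fun e he => by
        rw [Function.update_of_ne (fun h => hnot (by rwa [← h]))]
    refine ⟨insert (t⁻¹ • k) E, ⟨?_, ?_⟩, ?_⟩
    · refine Finset.forall_mem_insert _ _ _ |>.2 ⟨?_, hE1⟩
      rw [map_smul, map_smul, LinearMap.smul_apply, ← htt, smul_eq_mul, smul_eq_mul]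
      field_simp
    · refine Finset.forall_mem_insert _ _ _ |>.2
        ⟨Finset.forall_mem_insert _ _ _ |>.2 ⟨fun h => (h rfl).elim, fun e he _ => he' e he⟩,
          fun e he => Finset.forall_mem_insert _ _ _ |>.2
            ⟨fun _ => by rw [q.symm, he' e he], hE2 e he⟩⟩
    · refine Finset.forall_mem_insert _ _ _ |>.2
        ⟨⟨Function.update (q.bilin v) (t⁻¹ • k) t, ?_, ?_⟩, fun w hw => ?_⟩
      · rw [Finset.sum_insert hnot, Function.update_self, smul_smul, mul_inv_cancel₀ ht0, one_smul,
          hupd _ _ fun e s => s • e]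
        have : v - (k + ∑ e ∈ E, q.bilin v e • e) = 0 := by rw [hk]; abel
        rw [this, map_zero]
      · rw [Finset.sum_insert hnot, Function.update_self, hupd', hvv, sq t, htt, add_comm]
      · obtain ⟨c, hc1, hc2⟩ := hE w hw
        refine ⟨Function.update c (t⁻¹ • k) 0, ?_, ?_⟩
        · rwa [Finset.sum_insert hnot, Function.update_self, zero_smul, zero_add,
            hupd _ _ fun e s => s • e]
        · rwa [Finset.sum_insert hnot, Function.update_self, hupd', sq, zero_mul, zero_add]

theorem bilin_eq_zero_of_trace_lt_top {p q : HilbSeminorm V} (h : p.trace q < ⊤) {v : V}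
    (hv : q.bilin v v = 0) : p.bilin v v = 0 := by
  rw [trace] at h
  split_ifs at h with h'
  · exact h' v hv
  · exact (lt_irrefl _ h).elim

theorem sum_le_trace {p q : HilbSeminorm V} {E : Finset V} (hE : q.IsONS E) :
    ENNReal.ofReal (∑ e ∈ E, p.bilin e e) ≤ p.trace q := by
  rw [trace]
  split_ifs with h'
  · exact le_iSup₂ (f := fun (E : Finset V) (_ : q.IsONS E) =>
      ENNReal.ofReal (∑ e ∈ E, p.bilin e e)) E hE
  · exact le_top

end HilbSeminorm

end Trace

section TauAdditivity

/-- Measures that are inner regular on open sets are `τ`-additive. -/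
theorem measure_iUnion_le_of_finset {X ι : Type*} [TopologicalSpace X] [MeasurableSpace X]
    {μ : Measure X} (hμ : μ.InnerRegularWRT IsCompact IsOpen) {U : ι → Set X}
    (hU : ∀ i, IsOpen (U i)) {c : ℝ≥0∞} (hc : ∀ s : Finset ι, μ (⋃ i ∈ s, U i) ≤ c) :
    μ (⋃ i, U i) ≤ c := by
  refine le_of_forall_lt fun r hr => ?_
  obtain ⟨K, hKU, hK, hrK⟩ := hμ (isOpen_iUnion hU) r hr
  obtain ⟨s, hs⟩ := hK.elim_finite_subcover U hU hKU
  exact hrK.trans_le ((measure_mono hs).trans (hc s))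

end TauAdditivity

section Existence

variable {A : Type*} [CommRing A] [Algebra ℝ A]

instance Character.instBorelSpace : BorelSpace (Character A) := ⟨rfl⟩

theorem Character.continuous_eval (a : A) : Continuous fun α : Character A => α a :=
  (continuous_apply a).comp continuous_induced_dom

theorem Character.measurable_eval (a : A) : Measurable fun α : Character A => α a :=
  (Character.continuous_eval a).measurable

instance Character.instT2Space : T2Space (Character A) :=
  (Topology.IsEmbedding.mk (Topology.IsInducing.mk rfl) DFunLike.coe_injective :
    Topology.IsEmbedding fun (α : Character A) (a : A) => α a).t2Space

section

variable {V : Submodule ℝ A} {Y : Type*} [TopologicalSpace Y] {r : V → C(Y, ℂ)}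

/-- The closed set of those points at which `v ↦ x v y` is defined and bounded by `C * q`. -/
def bddSet (q : HilbSeminorm V) (r : V → C(Y, ℂ)) (C : ℝ) : Set Y :=
  {y | ∀ v, ‖1 - Complex.I * r v y‖ ≤ C * q.toFun v * ‖r v y‖}

theorem isClosed_bddSet (q : HilbSeminorm V) (r : V → C(Y, ℂ)) (C : ℝ) :
    IsClosed (bddSet q r C) := by
  simp only [bddSet, Set.ofPred_forall]
  exact isClosed_iInter fun v => isClosed_le (by fun_prop) (by fun_prop)

theorem ne_zero_of_mem_bddSet {q : HilbSeminorm V} {C : ℝ} {y : Y} (hy : y ∈ bddSet q r C) (v : V) :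
    r v y ≠ 0 := fun h => by
  have := hy v
  rw [h] at this
  simp at this
  linarith

end

/-- The elements of the subspace `V` are represented by real-valued functions on `Y`, whose joint
moments with respect to `μ` are given by `L`. The functions are encoded by their resolvents `r`. -/
structure IsMomentModel (V : Submodule ℝ A) (L : A →ₗ[ℝ] ℝ) {Y : Type*} [TopologicalSpace Y]
    [MeasurableSpace Y] (μ : Measure Y) (r : V → C(Y, ℂ)) (x : V → Y → ℝ) : Prop where
  inv_eq : ∀ {v y}, r v y ≠ 0 → (r v y)⁻¹ = x v y + Complex.I
  measurable : ∀ v, Measurable (x v)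
  ae_ne_zero : ∀ v, ∀ᵐ y ∂μ, r v y ≠ 0
  integrable : ∀ P : MvPolynomial V ℝ, Integrable (fun y => MvPolynomial.eval (x · y) P) μ
  integral_eq : ∀ P : MvPolynomial V ℝ, ∫ y, MvPolynomial.eval (x · y) P ∂μ =
    L (MvPolynomial.aeval (fun v : V => (v : A)) P)

namespace IsMomentModel

variable {V : Submodule ℝ A} {L : A →ₗ[ℝ] ℝ} {Y : Type*} [TopologicalSpace Y] [MeasurableSpace Y]
  {μ : Measure Y} {r : V → C(Y, ℂ)} {x : V → Y → ℝ}

theorem ae_eval_eq_zero (M : IsMomentModel V L μ r x) {P : MvPolynomial V ℝ}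
    (hP : L (MvPolynomial.aeval (fun v : V => (v : A)) P *
      MvPolynomial.aeval (fun v : V => (v : A)) P) = 0) :
    ∀ᵐ y ∂μ, MvPolynomial.eval (x · y) P = 0 := by
  have h1 := M.integrable (P * P)
  have h2 := M.integral_eq (P * P)
  simp only [map_mul] at h1 h2
  rw [hP, integral_eq_zero_iff_of_nonneg (fun y => mul_self_nonneg _) h1] at h2
  filter_upwards [h2] with y hy using mul_self_eq_zero.1 hy

theorem measure_finset_le (M : IsMomentModel V L μ r x) (hL : ∀ a, 0 ≤ L (a * a))
    (q : HilbSeminorm V) (htr : ((sLSeminorm L hL).comp V.subtype).trace q < ⊤) {C : ℝ}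
    (hC : 0 < C) (F : Finset V) :
    μ {y | ∃ v ∈ F, C * q.toFun v < |x v y|} ≤
      ((sLSeminorm L hL).comp V.subtype).trace q / ENNReal.ofReal (C ^ 2) := by
  obtain ⟨E, hE, hF⟩ := q.exists_isONS F
  choose! c hc1 hc2 using hF
  have hae : ∀ v ∈ F, ∀ᵐ y ∂μ, x v y = ∑ e ∈ E, c v e * x e y := fun v hv => by
    have h1 := HilbSeminorm.bilin_eq_zero_of_trace_lt_top htr (hc1 v hv)
    have h2 : MvPolynomial.aeval (fun v : V => (v : A))
        (MvPolynomial.X v - ∑ e ∈ E, MvPolynomial.C (c v e) * MvPolynomial.X e) =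
        ((v - ∑ e ∈ E, c v e • e : V) : A) := by
      simp [Algebra.smul_def]
    have h3 := M.ae_eval_eq_zero (P := MvPolynomial.X v -
      ∑ e ∈ E, MvPolynomial.C (c v e) * MvPolynomial.X e) (by rw [h2]; exact h1)
    filter_upwards [h3] with y hy
    simpa [sub_eq_zero] using hy
  have hS : Integrable (fun y => ∑ e ∈ E, x e y ^ 2) μ ∧
      ∫ y, ∑ e ∈ E, x e y ^ 2 ∂μ = ∑ e ∈ E, L (e * e : A) := by
    have h1 := M.integrable (∑ e ∈ E, MvPolynomial.X e ^ 2)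
    have h2 := M.integral_eq (∑ e ∈ E, MvPolynomial.X e ^ 2)
    simp only [map_sum, map_pow, MvPolynomial.eval_X, MvPolynomial.aeval_X] at h1 h2
    exact ⟨h1, h2.trans (by simp only [sq])⟩
  have hmarkov : μ {y | ENNReal.ofReal (C ^ 2) ≤ ENNReal.ofReal (∑ e ∈ E, x e y ^ 2)} ≤
      ((sLSeminorm L hL).comp V.subtype).trace q / ENNReal.ofReal (C ^ 2) := by
    refine (meas_ge_le_lintegral_div hS.1.aemeasurable.ennreal_ofReal
      (by simp [hC.ne']) ENNReal.ofReal_ne_top).trans ?_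
    rw [← ofReal_integral_eq_lintegral_ofReal hS.1
      (ae_of_all _ fun y => Finset.sum_nonneg fun e _ => sq_nonneg _), hS.2]
    gcongr
    exact HilbSeminorm.sum_le_trace hE
  refine (measure_mono_ae ?_).trans hmarkov
  have hae' : ∀ᵐ y ∂μ, ∀ v ∈ F, x v y = ∑ e ∈ E, c v e * x e y :=
    (Finset.eventually_all F).2 hae
  filter_upwards [hae'] with y hy
  rintro ⟨v, hv, hlt⟩
  refine ENNReal.ofReal_le_ofReal (le_of_lt ?_)
  by_contra! hle
  refine hlt.not_ge (abs_le_of_sq_le_sq ?_ (mul_nonneg hC.le (q.toFun_nonneg v)))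
  rw [hy v hv, mul_pow, HilbSeminorm.toFun_sq, mul_comm]
  exact (Finset.sum_mul_sq_le_sq_mul_sq E (c v) (x · y)).trans
    (mul_le_mul (hc2 v hv) hle (Finset.sum_nonneg fun e _ => sq_nonneg _) (q.nonneg v))

theorem norm_one_sub_le_iff (M : IsMomentModel V L μ r x) {v : V} {y : Y} (h : r v y ≠ 0) {t : ℝ} :
    ‖1 - Complex.I * r v y‖ ≤ t * ‖r v y‖ ↔ |x v y| ≤ t := by
  have h1 : 1 - Complex.I * r v y = (x v y : ℂ) * r v y := by
    rw [← sub_eq_iff_eq_add.2 (M.inv_eq h), sub_mul, inv_mul_cancel₀ h]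
  rw [h1, norm_mul, Complex.norm_real, Real.norm_eq_abs,
    mul_le_mul_iff_left₀ (norm_pos_iff.2 h)]

theorem measure_compl_bddSet_le [BorelSpace Y] (M : IsMomentModel V L μ r x)
    (hμ : μ.InnerRegularWRT IsCompact IsOpen) (hL : ∀ a, 0 ≤ L (a * a))
    (q : HilbSeminorm V) (htr : ((sLSeminorm L hL).comp V.subtype).trace q < ⊤) {C : ℝ}
    (hC : 0 < C) :
    μ (bddSet q r C)ᶜ ≤
      ((sLSeminorm L hL).comp V.subtype).trace q / ENNReal.ofReal (C ^ 2) := by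
  have h : (bddSet q r C)ᶜ = ⋃ v, {y | C * q.toFun v * ‖r v y‖ < ‖1 - Complex.I * r v y‖} := by
    ext y
    simp [bddSet]
  rw [h]
  refine measure_iUnion_le_of_finset hμ
    (fun v => isOpen_lt (by fun_prop) (by fun_prop)) fun s => ?_
  refine (measure_mono_ae ?_).trans (M.measure_finset_le hL q htr hC s)
  have hae : ∀ᵐ y ∂μ, ∀ v ∈ s, r v y ≠ 0 :=
    (Finset.eventually_all s).2 fun v _ => M.ae_ne_zero v
  filter_upwards [hae] with y hy hmem
  obtain ⟨v, hv, hlt⟩ := Set.mem_iUnion₂.1 hmem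
  exact ⟨v, hv, not_le.1 fun hle => hlt.not_ge ((M.norm_one_sub_le_iff (hy v hv)).2 hle)⟩

theorem continuousOn_eval (M : IsMomentModel V L μ r x) (P : MvPolynomial V ℝ) :
    ContinuousOn (fun y => MvPolynomial.eval (x · y) P) {y | ∀ v, r v y ≠ 0} := by
  refine (MvPolynomial.continuous_eval P).comp_continuousOn (continuousOn_pi.2 fun v => ?_)
  have h : ContinuousOn (fun y => ((r v y)⁻¹).re) {y | ∀ v, r v y ≠ 0} :=
    Complex.continuous_re.comp_continuousOn ((r v).continuous.continuousOn.inv₀ fun y hy => hy v)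
  exact h.congr fun y hy => by simp [M.inv_eq (hy v)]

/-- The closed set of those points of `bddSet` which define a character. -/
def charSet (q : HilbSeminorm V) (r : V → C(Y, ℂ)) (x : V → Y → ℝ) (C : ℝ) : Set Y :=
  {y | y ∈ bddSet q r C ∧ ∀ P : MvPolynomial V ℝ,
    MvPolynomial.aeval (fun v : V => (v : A)) P = 0 → MvPolynomial.eval (x · y) P = 0}

theorem isClosed_charSet_and_measure_le [BorelSpace Y] (M : IsMomentModel V L μ r x)
    (hμ : μ.InnerRegularWRT IsCompact IsOpen) (hL : ∀ a, 0 ≤ L (a * a))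
    (q : HilbSeminorm V) (htr : ((sLSeminorm L hL).comp V.subtype).trace q < ⊤) {C : ℝ}
    (hC : 0 < C) :
    IsClosed (charSet q r x C) ∧ μ (charSet q r x C)ᶜ ≤
      ((sLSeminorm L hL).comp V.subtype).trace q / ENNReal.ofReal (C ^ 2) := by
  let ker := {P : MvPolynomial V ℝ // MvPolynomial.aeval (fun v : V => (v : A)) P = 0}
  have hcl : ∀ P : ker, IsClosed
      (bddSet q r C ∩ (fun y => MvPolynomial.eval (x · y) P.1) ⁻¹' {0}) := fun P =>
    ((M.continuousOn_eval P.1).mono fun y hy v => ne_zero_of_mem_bddSet hy v)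
      |>.preimage_isClosed_of_isClosed (isClosed_bddSet q r C) isClosed_singleton
  have h : charSet q r x C =
      ⋂ P : ker, bddSet q r C ∩ (fun y => MvPolynomial.eval (x · y) P.1) ⁻¹' {0} := by
    ext y
    simp only [charSet, Set.mem_ofPred_eq, Set.mem_iInter, Set.mem_inter_iff, Set.mem_preimage,
      Set.mem_singleton_iff]
    exact ⟨fun hy P => ⟨hy.1, hy.2 P.1 P.2⟩, fun hy => ⟨(hy ⟨0, map_zero _⟩).1,
      fun P hP => (hy ⟨P, hP⟩).2⟩⟩
  refine ⟨h ▸ isClosed_iInter hcl, ?_⟩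
  rw [h, Set.compl_iInter]
  refine measure_iUnion_le_of_finset hμ (fun P => (hcl P).isOpen_compl) fun s => ?_
  refine (measure_mono_ae ?_).trans (M.measure_compl_bddSet_le hμ hL q htr hC)
  have hae : ∀ᵐ y ∂μ, ∀ P ∈ s, MvPolynomial.eval (x · y) P.1 = 0 :=
    (Finset.eventually_all s).2 fun P _ => M.ae_eval_eq_zero (by rw [P.2, zero_mul, map_zero])
  filter_upwards [hae] with y hy hmem hbdd
  obtain ⟨P, hP, hn⟩ := Set.mem_iUnion₂.1 hmem
  exact hn ⟨hbdd, hy P hP⟩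

end IsMomentModel

end Existence

section Existence

/-- The image of a finite regular measure under a map that is continuous on a closed or, more
generally, measurable conull set is a Radon measure. -/
theorem isRadonMeasure_map {X Y : Type*} [TopologicalSpace X] [T2Space X] [MeasurableSpace X]
    [BorelSpace X] [TopologicalSpace Y] [MeasurableSpace Y] [BorelSpace Y]
    {μ : Measure Y} [IsFiniteMeasure μ] [μ.Regular] {T : Y → X} (hT : Measurable T) {S : Set Y}
    (hS : MeasurableSet S) (hS0 : μ Sᶜ = 0) (hTS : ContinuousOn T S) :
    IsRadonMeasure (μ.map T) := by
  refine ⟨inferInstance, fun B hB r hr => ?_⟩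
  rw [Measure.map_apply hT hB, ← measure_inter_conull hS0] at hr
  obtain ⟨K, hK, hKc, hrK⟩ := ((hT hB).inter hS).exists_lt_isCompact_of_ne_top
    (measure_ne_top _ _) hr
  have hTK : IsCompact (T '' K) := hKc.image_of_continuousOn (hTS.mono fun y hy => (hK hy).2)
  refine ⟨T '' K, Set.image_subset_iff.2 fun y hy => (hK hy).1, hTK, ?_⟩
  rw [Measure.map_apply hT hTK.measurableSet]
  exact hrK.trans_le (measure_mono (Set.subset_preimage_image T K))

variable {A : Type*} [CommRing A] [Algebra ℝ A] {V : Submodule ℝ A} {L : A →ₗ[ℝ] ℝ}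

theorem aeval_surjective (hgen : Algebra.adjoin ℝ (V : Set A) = ⊤) :
    Function.Surjective (MvPolynomial.aeval (R := ℝ) (fun v : V => (v : A))) := by
  rw [← AlgHom.range_eq_top, ← Algebra.adjoin_range_eq_range_aeval]
  simpa using hgen

theorem exists_character_aeval (hgen : Algebra.adjoin ℝ (V : Set A) = ⊤) {z : V → ℝ}
    (hz : ∀ P : MvPolynomial V ℝ, MvPolynomial.aeval (fun v : V => (v : A)) P = 0 →
      MvPolynomial.eval z P = 0) :
    ∃ α : Character A, ∀ P : MvPolynomial V ℝ,
      α (MvPolynomial.aeval (fun v : V => (v : A)) P) = MvPolynomial.eval z P := by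
  let φ := Ideal.Quotient.liftₐ (RingHom.ker (MvPolynomial.aeval (R := ℝ) fun v : V => (v : A)))
    (MvPolynomial.aeval z) fun P hP => hz P hP
  refine ⟨φ.comp
    (Ideal.quotientKerAlgEquivOfSurjective (aeval_surjective hgen)).symm.toAlgHom, fun P => ?_⟩
  have h : (Ideal.quotientKerAlgEquivOfSurjective (aeval_surjective hgen)).symm
      (MvPolynomial.aeval (fun v : V => (v : A)) P) = Ideal.Quotient.mk _ P :=
    (AlgEquiv.symm_apply_eq _).2 rfl
  exact congrArg φ h

theorem measurableSet_qContOn (V : Submodule ℝ A) (q : HilbSeminorm V) :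
    MeasurableSet {α : Character A | QContOn V q.toFun α} := by
  have h : {α : Character A | QContOn V q.toFun α} =
      ⋃ n : ℕ, ⋂ v : V, {α | |α (v : A)| ≤ (n + 1) * q.toFun v} := by
    ext α
    simp only [QContOn, Set.mem_ofPred_eq, Set.mem_iUnion, Set.mem_iInter]
    constructor
    · rintro ⟨C, -, hC⟩
      obtain ⟨n, hn⟩ := exists_nat_ge C
      exact ⟨n, fun v => (hC v).trans
        (mul_le_mul_of_nonneg_right (by linarith) (q.toFun_nonneg v))⟩
    · rintro ⟨n, hn⟩
      exact ⟨n + 1, n.cast_add_one_pos, hn⟩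
  rw [h]
  exact MeasurableSet.iUnion fun n => (isClosed_iInter fun v =>
    isClosed_le (Character.continuous_eval _).abs continuous_const).measurableSet

/-- A functional satisfying the Carleman conditions and a trace condition is represented by a
measure supported by the continuous characters. -/
theorem exists_representing_measure (hgen : Algebra.adjoin ℝ (V : Set A) = ⊤)
    (hL1 : L 1 = 1) (hL : ∀ a : A, 0 ≤ L (a * a))
    (hb : ∀ v : V, ∑' n : ℕ, (ENNReal.ofReal ((L ((v : A) ^ (2 * (n + 1)))) ^
      ((1 : ℝ) / (2 * (n + 1) : ℝ))))⁻¹ = ⊤)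
    (q : HilbSeminorm V) (htr : ((sLSeminorm L hL).comp V.subtype).trace q < ⊤)
    (α₀ : Character A) :
    ∃ ν : Measure (Character A), IsRadonMeasure ν ∧ IsProbabilityMeasure ν ∧
      (∀ a : A, Integrable (fun α : Character A => α a) ν ∧
        ∫ α : Character A, α a ∂ν = L a) ∧ ∀ᵐ α ∂ν, QContOn V q.toFun α := by
  classical
  obtain ⟨Y, _, _, _, _, _, μ, _, _, r, x, h1, h2, h3, h4⟩ := exists_moment_model V hL1 hL hb
  have M : IsMomentModel V L μ r x :=
    ⟨@h1, h2, h3, fun P => (h4 P).1, fun P => (h4 P).2⟩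
  have hμ : μ.InnerRegularWRT IsCompact IsOpen := Measure.Regular.innerRegular
  let S : Set Y := ⋃ n : ℕ, IsMomentModel.charSet q r x (n + 1 : ℝ)
  have hcl := fun n : ℕ => M.isClosed_charSet_and_measure_le hμ hL q htr
    (C := (n + 1 : ℝ)) n.cast_add_one_pos
  have hS : MeasurableSet S := MeasurableSet.iUnion fun n => (hcl n).1.measurableSet
  have hS0 : μ Sᶜ = 0 := by
    have hlim : Filter.Tendsto (fun n : ℕ => ((sLSeminorm L hL).comp V.subtype).trace q /
        ENNReal.ofReal ((n + 1 : ℝ) ^ 2)) Filter.atTop (nhds 0) := by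
      have : Filter.Tendsto (fun n : ℕ => ENNReal.ofReal ((n + 1 : ℝ) ^ 2))
          Filter.atTop (nhds ⊤) := by
        refine ENNReal.tendsto_ofReal_atTop.comp ?_
        exact (Filter.tendsto_pow_atTop two_ne_zero).comp
          (Filter.tendsto_atTop_add_const_right _ _ tendsto_natCast_atTop_atTop)
      simpa using ENNReal.Tendsto.const_div this (Or.inr htr.ne)
    refine le_antisymm (ge_of_tendsto' hlim fun n => ?_) zero_le
    exact (measure_mono (Set.compl_subset_compl.2 (Set.subset_iUnion _ n))).trans (hcl n).2
  have hSr : S ⊆ {y | ∀ v, r v y ≠ 0} := Set.iUnion_subset fun n y hy v =>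
    ne_zero_of_mem_bddSet hy.1 v
  have hSchar : ∀ y, ∃ α : Character A, (y ∈ S → ∀ P : MvPolynomial V ℝ,
      α (MvPolynomial.aeval (fun v : V => (v : A)) P) = MvPolynomial.eval (x · y) P) ∧
      (y ∉ S → α = α₀) := fun y => by
    by_cases hy : y ∈ S
    · obtain ⟨n, hn⟩ := Set.mem_iUnion.1 hy
      obtain ⟨α, hα⟩ := exists_character_aeval hgen hn.2
      exact ⟨α, fun _ => hα, fun h => (h hy).elim⟩
    · exact ⟨α₀, fun h => (hy h).elim, fun _ => rfl⟩
  choose T hT1 hT2 using hSchar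
  have hTS : ContinuousOn T S := by
    rw [continuousOn_iff_continuous_domRestrict, continuous_induced_rng, continuous_pi_iff]
    intro a
    obtain ⟨P, rfl⟩ := aeval_surjective hgen a
    have := ((M.continuousOn_eval P).mono hSr).domRestrict
    exact this.congr fun y => (hT1 y y.2 P).symm
  have hT : Measurable T := by
    have : T = S.piecewise T fun _ => α₀ := by
      ext1 y
      by_cases hy : y ∈ S
      · rw [Set.piecewise_eq_of_mem _ _ _ hy]
      · rw [Set.piecewise_eq_of_notMem _ _ _ hy, hT2 y hy]
    rw [this]
    exact hTS.measurable_piecewise continuousOn_const hS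
  have hSae : ∀ᵐ y ∂μ, y ∈ S := hS0
  have hae : ∀ P : MvPolynomial V ℝ, (fun y => MvPolynomial.eval (x · y) P) =ᵐ[μ]
      fun y => T y (MvPolynomial.aeval (fun v : V => (v : A)) P) := fun P => by
    filter_upwards [hSae] with y hy using (hT1 y hy P).symm
  refine ⟨μ.map T, isRadonMeasure_map hT hS hS0 hTS, ?_, fun a => ?_, ?_⟩
  · have : IsProbabilityMeasure μ := by
      have h := M.integral_eq 1
      simp only [map_one, integral_const, smul_eq_mul, mul_one, hL1] at h
      exact isProbabilityMeasure_iff_real.2 h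
    exact Measure.isProbabilityMeasure_map hT.aemeasurable
  · obtain ⟨P, rfl⟩ := aeval_surjective hgen a
    have hm := (Character.measurable_eval
      (MvPolynomial.aeval (fun v : V => (v : A)) P)).aestronglyMeasurable (μ := μ.map T)
    constructor
    · rw [integrable_map_measure hm hT.aemeasurable]
      exact (M.integrable P).congr (hae P)
    · rw [integral_map hT.aemeasurable hm, ← integral_congr_ae (hae P), M.integral_eq P]
  · rw [ae_map_iff hT.aemeasurable (measurableSet_qContOn V q)]
    filter_upwards [hSae] with y hy
    obtain ⟨n, hn⟩ := Set.mem_iUnion.1 hy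
    refine ⟨n + 1, n.cast_add_one_pos, fun v => ?_⟩
    have hTv := hT1 y hy (MvPolynomial.X v)
    rw [MvPolynomial.aeval_X, MvPolynomial.eval_X] at hTv
    rw [hTv]
    exact (M.norm_one_sub_le_iff (hSr hy v)).1 (hn.1 v)

end Existence

section ResolventStep

open scoped ComplexConjugate

variable {X : Type*} [MeasurableSpace X] {w : Measure X} {t y k : X → ℝ}

theorem one_le_norm_ofReal_add_I (a : ℝ) : 1 ≤ ‖(a : ℂ) + Complex.I‖ := by
  simpa using Complex.abs_im_le_norm ((a : ℂ) + Complex.I)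

/-- If the moments of `t` satisfy a Carleman condition, then orthogonality to all `t ^ n * y`
is preserved by multiplication with the resolvent of `t`. -/
theorem integral_resolvent_mul_eq_zero (ht : Measurable t) (hk : MemLp k 2 w)
    (hy : ∀ n : ℕ, MemLp (fun α => t α ^ n * y α) 2 w)
    {u : ℕ → ℝ} (hu : ∀ n, 0 ≤ u n) (hns : ¬ Summable u) {B : ℝ}
    (hB : ∀ n : ℕ, (∫ α, t α ^ (2 * (n + 1)) * y α ^ 2 ∂w) * u n ^ (2 * (n + 1)) ≤ B)
    (h0 : ∀ n : ℕ, ∫ α, k α * (t α ^ n * y α) ∂w = 0) (l : ℂ →L[ℝ] ℝ) :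
    ∫ α, l ((t α : ℂ) + Complex.I)⁻¹ * (k α * y α) ∂w = 0 := by
  have hy' : ∀ n : ℕ, MemLp (fun α => ((t α ^ n * y α : ℝ) : ℂ)) 2 w := fun n => (hy n).ofReal
  have hrk : MemLp (fun α => ((t α : ℂ) + Complex.I)⁻¹ * (k α : ℝ)) 2 w := by
    refine hk.mono ?_ (ae_of_all _ fun α => ?_)
    · have h1 : Measurable fun α => ((t α : ℂ) + Complex.I)⁻¹ := by fun_prop
      exact h1.aestronglyMeasurable.mul (Complex.continuous_ofReal.comp_aestronglyMeasurable hk.1)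
    · rw [norm_mul, Complex.norm_real, norm_inv]
      exact mul_le_of_le_one_left (norm_nonneg _) (inv_le_one_of_one_le₀
        (one_le_norm_ofReal_add_I _))
  have hξ : MemLp (fun α => conj (((t α : ℂ) + Complex.I)⁻¹ * (k α : ℝ))) 2 w :=
    hrk.mono (Complex.continuous_conj.comp_aestronglyMeasurable hrk.1)
      (ae_of_all _ fun α => (RCLike.norm_conj _).le)
  have hin : ∀ n, inner ℂ (hξ.toLp _) ((hy' n).toLp _) =
      ∫ α, ((t α : ℂ) + Complex.I)⁻¹ * (k α * (t α ^ n * y α) : ℝ) ∂w := fun n => by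
    rw [L2.inner_def]
    refine integral_congr_ae ?_
    filter_upwards [hξ.coeFn_toLp, (hy' n).coeFn_toLp] with α h1 h2
    rw [h1, h2, RCLike.inner_apply, RCLike.conj_conj]
    push_cast
    ring
  have hint : ∀ n, Integrable (fun α => ((t α : ℂ) + Complex.I)⁻¹ *
      (k α * (t α ^ n * y α) : ℝ)) w := fun n => by
    refine (hrk.integrable_mul (hy' n)).congr (ae_of_all _ fun α => ?_)
    simp only [Pi.mul_apply]
    push_cast
    ring
  have key := inner_eq_zero_of_hankel (x := fun n => (hy' n).toLp _) (ξ := hξ.toLp _)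
    (s := -Complex.I) (u := u) (K := √B) (fun m n => ?_) (by simp) (fun n => ?_) hu hns fun n => ?_
  · rw [hin] at key
    have h1 := l.integral_comp_comm (hint 0)
    rw [key, map_zero] at h1
    rw [← h1]
    refine integral_congr_ae (ae_of_all _ fun α => ?_)
    simp only [pow_zero, one_mul]
    rw [mul_comm, mul_comm _ ((_ : ℝ) : ℂ), ← Complex.real_smul, map_smul, smul_eq_mul]
  · rw [L2.inner_def, L2.inner_def]
    refine integral_congr_ae ?_
    filter_upwards [(hy' n).coeFn_toLp, (hy' m).coeFn_toLp, (hy' (n + 1)).coeFn_toLp,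
      (hy' (m + 1)).coeFn_toLp] with α h1 h2 h3 h4
    rw [h1, h2, h3, h4, RCLike.inner_apply, RCLike.inner_apply, Complex.conj_ofReal,
      Complex.conj_ofReal]
    push_cast
    ring
  · rw [hin, hin, ← integral_const_mul]
    have h1 : ∫ α, ((k α * (t α ^ n * y α) : ℝ) : ℂ) ∂w = 0 := by
      rw [integral_complex_ofReal, h0 n, Complex.ofReal_zero]
    rw [← sub_zero (∫ α, -Complex.I * _ ∂w), ← neg_zero, sub_neg_eq_add, ← h1, ← integral_add]
    · refine integral_congr_ae (ae_of_all _ fun α => ?_)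
      have h2 : (t α : ℂ) + Complex.I ≠ 0 := norm_pos_iff.1
        (zero_lt_one.trans_le (one_le_norm_ofReal_add_I _))
      simp only
      field_simp
      push_cast
      ring
    · exact (hint n).const_mul _
    · exact (hk.integrable_mul (hy n)).ofReal
  · refine Real.le_sqrt_of_sq_le ((le_of_eq ?_).trans (hB n))
    rw [mul_pow, ← pow_mul, mul_comm (n + 1) 2]
    congr 1
    have h1 : inner ℂ ((hy' (n + 1)).toLp _) ((hy' (n + 1)).toLp _) =
        ((∫ α, t α ^ (2 * (n + 1)) * y α ^ 2 ∂w : ℝ) : ℂ) := by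
      rw [L2.inner_def, ← integral_complex_ofReal]
      refine integral_congr_ae ?_
      filter_upwards [(hy' (n + 1)).coeFn_toLp] with α hα
      rw [hα, RCLike.inner_apply, Complex.conj_ofReal]
      push_cast
      ring
    rw [← inner_self_eq_norm_sq (𝕜 := ℂ), h1]
    rfl

end ResolventStep

section CompactModel

/-- An integrable function on a space carrying an inner regular measure vanishes almost everywhere
if it is orthogonal to all pullbacks of continuous functions along an injection into a compact
Hausdorff space. -/
theorem ae_eq_zero_of_forall_integral_comp_mul_eq_zero {X P : Type*} [TopologicalSpace X]
    [T2Space X] [MeasurableSpace X] [BorelSpace X] [TopologicalSpace P] [CompactSpace P]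
    [T2Space P] {w : Measure X} [IsFiniteMeasure w] [w.InnerRegular] {Φ : X → P}
    (hΦ : Continuous Φ) (hΦi : Function.Injective Φ) {G : X → ℝ} (hG : Integrable G w)
    (h : ∀ F : C(P, ℝ), ∫ α, F (Φ α) * G α ∂w = 0) : G =ᵐ[w] 0 := by
  refine hG.ae_eq_zero_of_forall_setIntegral_eq_zero fun s hs _ => ?_
  by_contra hne
  obtain ⟨δ, hδ, hδs⟩ := exists_pos_setLIntegral_lt_of_measure_lt hG.2.ne
    (ENNReal.ofReal_pos.2 (norm_pos_iff.2 hne)).ne'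
  obtain ⟨K₁, hK₁s, hK₁, hK₁δ⟩ := hs.exists_isCompact_sdiff_lt (measure_ne_top w s)
    (ENNReal.half_pos hδ.ne').ne'
  obtain ⟨K₂, hK₂s, hK₂, hK₂δ⟩ := hs.compl.exists_isCompact_sdiff_lt (measure_ne_top w sᶜ)
    (ENNReal.half_pos hδ.ne').ne'
  obtain ⟨F, hF₂, hF₁, hF01⟩ := exists_continuous_zero_one_of_isClosed
    (hK₂.image hΦ).isClosed (hK₁.image hΦ).isClosed
    ((Set.disjoint_image_iff hΦi).2 (Set.disjoint_of_subset hK₂s hK₁s disjoint_compl_left))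
  set R := (K₁ ∪ K₂)ᶜ with hR
  have hRm : MeasurableSet R := (hK₁.measurableSet.union hK₂.measurableSet).compl
  have hRδ : w R < δ := by
    have hsub : R ⊆ (s \ K₁) ∪ (sᶜ \ K₂) := fun α hα => by
      by_cases hαs : α ∈ s
      · exact Or.inl ⟨hαs, fun h => hα (Or.inl h)⟩
      · exact Or.inr ⟨hαs, fun h => hα (Or.inr h)⟩
    calc w R ≤ w (s \ K₁) + w (sᶜ \ K₂) := (measure_mono hsub).trans (measure_union_le _ _)
      _ < δ / 2 + δ / 2 := ENNReal.add_lt_add hK₁δ hK₂δ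
      _ = δ := ENNReal.add_halves δ
  have hFint : Integrable (fun α => F (Φ α) * G α) w :=
    hG.bdd_mul (c := 1) (F.continuous.comp hΦ).aestronglyMeasurable
      (ae_of_all _ fun α => by
        rw [Real.norm_of_nonneg (hF01 _).1]
        exact (hF01 _).2)
  have heq : ∫ α in s, G α ∂w = ∫ α, s.indicator G α - F (Φ α) * G α ∂w := by
    rw [integral_sub (hG.indicator hs) hFint, h F, sub_zero, integral_indicator hs]
  have hle : ∀ α, ‖s.indicator G α - F (Φ α) * G α‖ₑ ≤ R.indicator (fun α => ‖G α‖ₑ) α := by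
    intro α
    by_cases h1 : α ∈ K₁
    · rw [Set.indicator_of_mem (hK₁s h1), hF₁ (Set.mem_image_of_mem Φ h1)]
      simp
    by_cases h2 : α ∈ K₂
    · rw [Set.indicator_of_notMem (hK₂s h2), hF₂ (Set.mem_image_of_mem Φ h2)]
      simp
    have hα : α ∈ R := fun h => h.elim h1 h2
    rw [Set.indicator_of_mem hα, enorm_le_iff_norm_le]
    have h01 := hF01 (Φ α)
    by_cases h3 : α ∈ s
    · rw [Set.indicator_of_mem h3, ← one_sub_mul, norm_mul,
        Real.norm_of_nonneg (by linarith [h01.2])]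
      exact mul_le_of_le_one_left (norm_nonneg _) (by linarith [h01.1])
    · rw [Set.indicator_of_notMem h3, zero_sub, norm_neg, norm_mul, Real.norm_of_nonneg h01.1]
      exact mul_le_of_le_one_left (norm_nonneg _) h01.2
  refine lt_irrefl (ENNReal.ofReal ‖∫ α in s, G α ∂w‖) ?_
  calc ENNReal.ofReal ‖∫ α in s, G α ∂w‖ = ‖∫ α, s.indicator G α - F (Φ α) * G α ∂w‖ₑ := by
        rw [← heq, ofReal_norm]
    _ ≤ ∫⁻ α, ‖s.indicator G α - F (Φ α) * G α‖ₑ ∂w := enorm_integral_le_lintegral_enorm _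
    _ ≤ ∫⁻ α, R.indicator (fun α => ‖G α‖ₑ) α ∂w := lintegral_mono hle
    _ = ∫⁻ α in R, ‖G α‖ₑ ∂w := lintegral_indicator hRm _
    _ < _ := hδs R hRδ

/-- A function that is orthogonal to a cyclic vector and all its images under a point-separating
family of multiplication operators on a compact space is orthogonal to all continuous functions. -/
theorem integral_comp_mul_eq_zero_of_separatesPoints {X P κ : Type*} [MeasurableSpace X]
    [TopologicalSpace P] [CompactSpace P] {w : Measure X} {Φ : X → P} {G : κ → X → ℝ}
    (hF : ∀ F : C(P, ℝ), AEStronglyMeasurable (fun α => F (Φ α)) w)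
    (hG : ∀ i, Integrable (G i) w) {c : Set C(P, ℝ)}
    (hc : ∀ x y, x ≠ y → ∃ f ∈ c, f x ≠ f y)
    (hstep : ∀ f ∈ c, ∀ F : C(P, ℝ), (∀ i, ∫ α, F (Φ α) * G i α ∂w = 0) →
      ∀ i, ∫ α, (f * F) (Φ α) * G i α ∂w = 0)
    (h1 : ∀ i, ∫ α, G i α ∂w = 0) (F : C(P, ℝ)) (i : κ) : ∫ α, F (Φ α) * G i α ∂w = 0 := by
  have hint : ∀ (F : C(P, ℝ)) i, Integrable (fun α => F (Φ α) * G i α) w := fun F i =>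
    (hG i).bdd_mul (c := ‖F‖) (hF F) (ae_of_all _ fun α => F.norm_coe_le_norm _)
  let S : Subalgebra ℝ C(P, ℝ) :=
    { carrier := {f | ∀ F : C(P, ℝ), (∀ i, ∫ α, F (Φ α) * G i α ∂w = 0) →
        ∀ i, ∫ α, (f * F) (Φ α) * G i α ∂w = 0}
      mul_mem' := fun {f g} hf hg F hF => by
        simp only [mul_assoc f g F]
        exact hf _ (hg F hF)
      add_mem' := fun {f g} hf hg F hF i => by
        simp only [add_mul, ContinuousMap.add_apply]
        rw [integral_add (hint _ i) (hint _ i), hf F hF i, hg F hF i, add_zero]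
      algebraMap_mem' := fun r F hF i => by
        simp only [Algebra.algebraMap_eq_smul_one, ContinuousMap.mul_apply,
          ContinuousMap.smul_apply,
          ContinuousMap.one_apply, smul_eq_mul, mul_one, mul_assoc]
        rw [integral_const_mul, hF i, mul_zero] }
  have hS : S.topologicalClosure = ⊤ :=
    ContinuousMap.subalgebra_topologicalClosure_eq_top_of_separatesPoints S fun x y hxy => by
      obtain ⟨f, hf, hfxy⟩ := hc x y hxy
      exact ⟨f, ⟨f, hstep f hf, rfl⟩, hfxy⟩
  have hFS : F ∈ closure (S : Set C(P, ℝ)) := by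
    rw [← Subalgebra.topologicalClosure_coe, hS]
    trivial
  by_contra hne
  set N := ∫ α, ‖G i α‖ ∂w with hN
  have hN0 : 0 ≤ N := integral_nonneg fun α => norm_nonneg _
  have hpos := norm_pos_iff.2 hne
  obtain ⟨f, hf, hfd⟩ := Metric.mem_closure_iff.1 hFS (‖∫ α, F (Φ α) * G i α ∂w‖ / (N + 1))
    (by positivity)
  have hfi : ∫ α, f (Φ α) * G i α ∂w = 0 := by
    simpa using hf 1 (by simpa using h1) i
  have hle : ‖∫ α, F (Φ α) * G i α ∂w‖ ≤ dist F f * N := by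
    rw [← sub_zero (∫ α, F (Φ α) * G i α ∂w), ← hfi, ← integral_sub (hint F i) (hint f i), hN,
      ← integral_const_mul]
    refine norm_integral_le_of_norm_le ((hG i).norm.const_mul _) (ae_of_all _ fun α => ?_)
    rw [← sub_mul, norm_mul, ← dist_eq_norm]
    exact mul_le_mul_of_nonneg_right (ContinuousMap.dist_apply_le_dist _) (norm_nonneg _)
  rw [lt_div_iff₀ (by positivity)] at hfd
  nlinarith [dist_nonneg (x := F) (y := f)]

end CompactModel

section CharacterDensity

variable {A : Type*} [CommRing A] [Algebra ℝ A] {V : Submodule ℝ A}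

theorem memLp_eval_mul_sqrt {w : Measure (Character A)}
    (hw : ∀ a : A, Integrable (fun α : Character A => α a) w) {s : A}
    (hs : ∀ α : Character A, 0 ≤ α s) (x : A) :
    MemLp (fun α : Character A => α x * √(α s)) 2 w := by
  have hm : Measurable fun α : Character A => α x * √(α s) :=
    (Character.measurable_eval x).mul (Character.measurable_eval s).sqrt
  rw [memLp_two_iff_integrable_sq hm.aestronglyMeasurable]
  refine (hw (x ^ 2 * s)).congr (ae_of_all _ fun α => ?_)
  simp only
  rw [mul_pow, Real.sq_sqrt (hs α), map_mul, map_pow]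

/-- The map from the character space of an algebra into a compact space given by the resolvents of
the elements of `V`. -/
noncomputable def resolventMap (V : Submodule ℝ A) (α : Character A) :
    V → Metric.closedBall (0 : ℂ) 1 := fun v =>
  ⟨((α (v : A) : ℂ) + Complex.I)⁻¹, by
    rw [mem_closedBall_zero_iff, norm_inv]
    exact inv_le_one_of_one_le₀ (one_le_norm_ofReal_add_I _)⟩

theorem continuous_resolventMap : Continuous (resolventMap V) := by
  refine continuous_pi fun v => Continuous.subtype_mk ?_ _
  refine ((Complex.continuous_ofReal.comp (Character.continuous_eval _)).add
    continuous_const).inv₀ fun α => norm_pos_iff.1 ?_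
  exact zero_lt_one.trans_le (one_le_norm_ofReal_add_I _)

theorem resolventMap_injective (hgen : Algebra.adjoin ℝ (V : Set A) = ⊤) :
    Function.Injective (resolventMap V) := fun α β h => by
  refine AlgHom.ext_of_adjoin_eq_top hgen fun v hv => ?_
  have h1 := congrArg Subtype.val (congrFun h ⟨v, hv⟩)
  simpa [resolventMap] using h1

/-- Under a Carleman condition the algebra is dense in weighted `L²` spaces on the character
space. -/
theorem ae_eq_zero_of_forall_integral_mul_eq_zero (hgen : Algebra.adjoin ℝ (V : Set A) = ⊤)
    {w : Measure (Character A)} [IsFiniteMeasure w] [w.InnerRegular]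
    (hw : ∀ a : A, Integrable (fun α : Character A => α a) w)
    (hC : ∀ v : V, ∃ u : ℕ → ℝ, (∀ n, 0 ≤ u n) ∧ ¬ Summable u ∧ ∀ c : A, ∃ B, ∀ n : ℕ,
      (∫ α : Character A, α ((v : A) ^ (2 * (n + 1)) * c) ∂w) * u n ^ (2 * (n + 1)) ≤ B)
    {s : A} (hs : ∀ α : Character A, 0 < α s) {g : Character A → ℝ} (hg : MemLp g 2 w)
    (h0 : ∀ x : A, ∫ α : Character A, α x * (√(α s) * g α) ∂w = 0) : g =ᵐ[w] 0 := by
  have hx := memLp_eval_mul_sqrt hw fun α => (hs α).le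
  have hG : ∀ x : A, Integrable (fun α : Character A => α x * (√(α s) * g α)) w := fun x => by
    simp only [← mul_assoc]
    exact (hx x).integrable_mul hg
  have hbdd : ∀ F : C(V → Metric.closedBall (0 : ℂ) 1, ℝ),
      MemLp (fun α => F (resolventMap V α) * g α) 2 w := fun F => by
    refine hg.of_le_mul (c := ‖F‖)
      ((F.continuous.comp continuous_resolventMap).aestronglyMeasurable.mul hg.1)
      (ae_of_all _ fun α => ?_)
    rw [norm_mul]
    exact mul_le_mul_of_nonneg_right (F.norm_coe_le_norm _) (norm_nonneg _)
  have key := ae_eq_zero_of_forall_integral_comp_mul_eq_zero continuous_resolventMap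
    (resolventMap_injective hgen) (hG 1) fun F =>
    integral_comp_mul_eq_zero_of_separatesPoints
      (c := {f | ∃ (v : V) (l : ℂ →L[ℝ] ℝ), ∀ y, f y = l (y v)})
      (fun F => (F.continuous.comp continuous_resolventMap).aestronglyMeasurable) hG ?_ ?_ h0 F 1
  · filter_upwards [key] with α hα
    simpa [(Real.sqrt_pos.2 (hs α)).ne'] using hα
  · intro y z hyz
    obtain ⟨v, hv⟩ := Function.ne_iff.1 hyz
    have hcont : Continuous fun y : V → Metric.closedBall (0 : ℂ) 1 => (y v : ℂ) :=
      continuous_subtype_val.comp (continuous_apply v)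
    by_cases hre : (y v : ℂ).re = (z v : ℂ).re
    · exact ⟨⟨fun y => Complex.imCLM (y v), Complex.imCLM.continuous.comp hcont⟩,
        ⟨v, Complex.imCLM, fun _ => rfl⟩, fun him => hv (Subtype.ext (Complex.ext hre him))⟩
    · exact ⟨⟨fun y => Complex.reCLM (y v), Complex.reCLM.continuous.comp hcont⟩,
        ⟨v, Complex.reCLM, fun _ => rfl⟩, hre⟩
  · rintro f ⟨v, l, hf⟩ F hF x
    obtain ⟨u, hu, hns, hB⟩ := hC v
    obtain ⟨B, hB⟩ := hB (x ^ 2 * s)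
    have h1 := integral_resolvent_mul_eq_zero (t := fun α : Character A => α (v : A))
      (y := fun α => α x * √(α s)) (k := fun α => F (resolventMap V α) * g α) (B := B)
      (Character.measurable_eval _) (hbdd F)
      (fun n => by simpa [mul_assoc] using hx ((v : A) ^ n * x)) hu hns (fun n => ?_)
      (fun n => ?_) l
    · rw [← h1]
      refine integral_congr_ae (ae_of_all _ fun α => ?_)
      simp only [ContinuousMap.mul_apply, hf, resolventMap]
      ring
    · refine (le_of_eq ?_).trans (hB n)
      congr 2
      ext α
      rw [mul_pow, Real.sq_sqrt (hs α).le, map_mul, map_mul, map_pow, map_pow]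
    · rw [← hF ((v : A) ^ n * x)]
      refine integral_congr_ae (ae_of_all _ fun α => ?_)
      simp only [map_mul, map_pow]
      ring

end CharacterDensity

section RepresentingMeasures

variable {A : Type*} [CommRing A] [Algebra ℝ A] {V : Submodule ℝ A} {L : A →ₗ[ℝ] ℝ}
  {ν ν' : Measure (Character A)}

theorem isProbabilityMeasure_of_integral_eval_eq (hL1 : L 1 = 1)
    (hν : ∀ a : A, L a = ∫ α : Character A, α a ∂ν) : IsProbabilityMeasure ν := by
  have h := hν 1
  simp only [map_one, integral_const, smul_eq_mul, mul_one, hL1] at h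
  exact isProbabilityMeasure_iff_real.2 h.symm

theorem integrable_of_integral_eval_eq (hL1 : L 1 = 1)
    (hν : ∀ a : A, L a = ∫ α : Character A, α a ∂ν) (a : A) :
    Integrable (fun α : Character A => α a) ν := by
  have := isProbabilityMeasure_of_integral_eval_eq hL1 hν
  by_contra hn
  have hn' : ¬ Integrable (fun α : Character A => α (a + 1)) ν := fun h => hn <|
    (h.sub (integrable_const (1 : ℝ))).congr (ae_of_all _ fun α => by simp)
  have h1 := hν a
  have h2 := hν (a + 1)
  rw [integral_undef hn] at h1
  rw [integral_undef hn', map_add, h1, hL1] at h2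
  norm_num at h2

theorem eq_of_integral_eval_eq (hgen : Algebra.adjoin ℝ (V : Set A) = ⊤) (hL1 : L 1 = 1)
    (hL : ∀ a : A, 0 ≤ L (a * a))
    (hb : ∀ v : V, ∑' n : ℕ, (ENNReal.ofReal ((L ((v : A) ^ (2 * (n + 1)))) ^
      ((1 : ℝ) / (2 * (n + 1) : ℝ))))⁻¹ = ⊤)
    [ν.InnerRegular] [ν'.InnerRegular] (hν : ∀ a : A, L a = ∫ α : Character A, α a ∂ν)
    (hν' : ∀ a : A, L a = ∫ α : Character A, α a ∂ν') : ν = ν' := by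
  have := isProbabilityMeasure_of_integral_eval_eq hL1 hν
  have := isProbabilityMeasure_of_integral_eval_eq hL1 hν'
  have hi := integrable_of_integral_eval_eq hL1 hν
  have hi' := integrable_of_integral_eval_eq hL1 hν'
  have hw : ∀ a : A, Integrable (fun α : Character A => α a) (ν + ν') := fun a =>
    (hi a).add_measure (hi' a)
  have hint : ∀ a : A, ∫ α : Character A, α a ∂(ν + ν') = 2 * L a := fun a => by
    rw [integral_add_measure (hi a) (hi' a), ← hν, ← hν', two_mul]
  have hle : ν ≤ ν + ν' := Measure.le_add_right le_rfl
  have hac : ν ≪ ν + ν' := Measure.absolutelyContinuous_of_le hle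
  have hrn := Measure.rnDeriv_le_one_of_le hle
  have hg : MemLp (fun α => (ν.rnDeriv (ν + ν') α).toReal - 1 / 2) 2 (ν + ν') := by
    refine MemLp.of_bound ((Measure.measurable_rnDeriv _ _).ennreal_toReal.sub_const
      _).aestronglyMeasurable 1 ?_
    filter_upwards [hrn] with α hα
    have h1 := ENNReal.toReal_mono ENNReal.one_ne_top hα
    have h0 : 0 ≤ (ν.rnDeriv (ν + ν') α).toReal := ENNReal.toReal_nonneg
    rw [ENNReal.toReal_one] at h1
    rw [Real.norm_eq_abs, abs_le]
    constructor <;> linarith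
  have key := ae_eq_zero_of_forall_integral_mul_eq_zero hgen hw (fun v => ?_) (s := 1)
    (fun α => by simp) hg fun x => ?_
  · have hrn' : ν.rnDeriv (ν + ν') =ᵐ[ν + ν'] fun _ => 2⁻¹ := by
      filter_upwards [key, hrn] with α h1 h2
      rw [← ENNReal.ofReal_toReal (h2.trans_lt ENNReal.one_lt_top).ne, sub_eq_zero.1 h1,
        one_div, ENNReal.ofReal_inv_of_pos two_pos, ENNReal.ofReal_ofNat]
    have h1 := Measure.withDensity_rnDeriv_eq ν (ν + ν') hac
    rw [withDensity_congr_ae hrn', withDensity_const] at h1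
    have h2 : ν + ν' = ν + ν := by
      rw [← h1, ← add_smul, ENNReal.inv_two_add_inv_two, one_smul, h1]
    ext s hs
    have h3 := congrArg (fun m : Measure (Character A) => m s) h2
    simp only [Measure.add_apply] at h3
    exact ((ENNReal.add_right_inj (measure_ne_top ν s)).1 h3).symm
  · obtain ⟨u, hu, hns, h⟩ := exists_carleman_bound hL1 hL (hb v)
    refine ⟨u, hu, hns, fun c => ⟨2 * √(L (c * c)), fun n => ?_⟩⟩
    rw [hint, mul_assoc]
    exact mul_le_mul_of_nonneg_left (h c n) zero_le_two
  · have h1 := integral_rnDeriv_smul (f := fun α : Character A => α x) hac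
    have h2 := (integrable_rnDeriv_smul_iff (f := fun α : Character A => α x) hac).2 (hi x)
    have h3 : ∀ α : Character A, α x * (√(α 1) * ((ν.rnDeriv (ν + ν') α).toReal - 1 / 2)) =
        (ν.rnDeriv (ν + ν') α).toReal • α x - 1 / 2 * α x := fun α => by
      rw [map_one, Real.sqrt_one, smul_eq_mul]
      ring
    simp only [h3]
    rw [integral_sub h2 ((hw x).const_mul _), h1, integral_const_mul, hint, ← hν]
    ring

/-- Under the Carleman conditions, the representing measure of `L` is supported by the positivity
set of every element `a` with `L (x ^ 2 * a) ≥ 0` for all `x`. -/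
theorem measure_eval_neg_eq_zero (hgen : Algebra.adjoin ℝ (V : Set A) = ⊤) (hL1 : L 1 = 1)
    (hL : ∀ a : A, 0 ≤ L (a * a))
    (hb : ∀ v : V, ∑' n : ℕ, (ENNReal.ofReal ((L ((v : A) ^ (2 * (n + 1)))) ^
      ((1 : ℝ) / (2 * (n + 1) : ℝ))))⁻¹ = ⊤)
    [ν.InnerRegular] (hν : ∀ a : A, L a = ∫ α : Character A, α a ∂ν) {a : A}
    (ha : ∀ x : A, 0 ≤ L (x ^ 2 * a)) : ν {α : Character A | α a < 0} = 0 := by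
  have := isProbabilityMeasure_of_integral_eval_eq hL1 hν
  have hi := integrable_of_integral_eval_eq hL1 hν
  have hs : ∀ α : Character A, 0 < α (1 + a ^ 2) := fun α => by
    rw [map_add, map_one, map_pow]
    positivity
  have hx := memLp_eval_mul_sqrt hi fun α => (hs α).le
  have hneg : MeasurableSet {α : Character A | α a < 0} :=
    measurableSet_lt (Character.measurable_eval a) measurable_const
  let D : Submodule ℝ (Lp ℝ 2 ν) := LinearMap.range
    ({ toFun := fun x => (hx x).toLp _
       map_add' := fun x y => by
        rw [← MemLp.toLp_add]
        congr 1
        ext α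
        simp [add_mul]
       map_smul' := fun c x => by
        rw [RingHom.id_apply, ← MemLp.toLp_const_smul]
        congr 1
        ext α
        simp [mul_assoc] } : A →ₗ[ℝ] Lp ℝ 2 ν)
  have hD : Dᗮ = ⊥ := by
    refine (Submodule.eq_bot_iff _).2 fun g hg => ?_
    refine (Lp.eq_zero_iff_ae_eq_zero).2 ?_
    refine ae_eq_zero_of_forall_integral_mul_eq_zero hgen hi (fun v => ?_) hs (Lp.memLp g)
      fun x => ?_
    · obtain ⟨u, hu, hns, h⟩ := exists_carleman_bound hL1 hL (hb v)
      refine ⟨u, hu, hns, fun c => ⟨√(L (c * c)), fun n => ?_⟩⟩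
      rw [← hν]
      exact h c n
    · have h1 := (Submodule.mem_orthogonal D g).1 hg _ ⟨x, rfl⟩
      rw [L2.inner_def] at h1
      rw [← h1]
      refine integral_congr_ae ?_
      filter_upwards [(hx x).coeFn_toLp] with α hα
      simp only [LinearMap.coe_mk, AddHom.coe_mk, hα, real_inner_eq_re_inner]
      simp
      ring
  have hh : MemLp ({α : Character A | α a < 0}.indicator fun _ => (1 : ℝ)) 2 ν :=
    (memLp_const 1).indicator hneg
  have hclos : hh.toLp _ ∈ closure (D : Set (Lp ℝ 2 ν)) := by
    rw [← Submodule.topologicalClosure_coe, Submodule.topologicalClosure_eq_top_iff.2 hD]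
    trivial
  have hpt : ∀ (x : A) (α : Character A),
      {α : Character A | α a < 0}.indicator (fun α => -α a / (1 + α a ^ 2)) α + 2 * α (x ^ 2 * a) ≤
      2 * (α x * √(α (1 + a ^ 2)) -
        {α : Character A | α a < 0}.indicator (fun _ => (1 : ℝ)) α) ^ 2 := by
    intro x α
    have hf2 : (α x * √(α (1 + a ^ 2))) ^ 2 = α x ^ 2 * (1 + α a ^ 2) := by
      rw [mul_pow, Real.sq_sqrt (hs α).le, map_add, map_one, map_pow]
    set f := α x * √(α (1 + a ^ 2))
    have hp : 0 < 1 + α a ^ 2 := by positivity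
    obtain ⟨b, hab⟩ : ∃ b, α a = b * (1 + α a ^ 2) := ⟨α a / (1 + α a ^ 2), by field_simp⟩
    have hb : -α a / (1 + α a ^ 2) = -b := by
      rw [div_eq_iff hp.ne']
      linarith
    have hL : α (x ^ 2 * a) = f ^ 2 * b := by
      rw [hf2, map_mul, map_pow]
      linear_combination α x ^ 2 * hab
    have hb1 : |b| ≤ 1 := by
      have : |b| * (1 + α a ^ 2) = |α a| := by rw [← abs_of_pos hp, ← abs_mul, ← hab]
      nlinarith [sq_abs (α a), sq_nonneg (|α a| - 1), abs_nonneg b, abs_nonneg (α a)]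
    obtain ⟨hb2, hb3⟩ := abs_le.1 hb1
    rw [hL]
    by_cases h : α a < 0
    · have hb0 : b < 0 := by
        by_contra hb0
        nlinarith
      simp only [Set.indicator, Set.mem_ofPred_eq, h, if_true, hb]
      nlinarith [mul_nonneg (neg_nonneg.2 hb0.le) (sq_nonneg (2 * f - 1)),
        mul_nonneg (neg_le_iff_add_nonneg.1 hb2) (sq_nonneg (f - 1))]
    · simp only [Set.indicator, Set.mem_ofPred_eq, h, if_false]
      nlinarith [mul_nonneg (sub_nonneg.2 hb3) (sq_nonneg f)]
  have hG0 : ∀ α : Character A, 0 ≤ {α : Character A | α a < 0}.indicator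
      (fun α => -α a / (1 + α a ^ 2)) α := fun α =>
    Set.indicator_nonneg (fun α (hα : α a < 0) =>
      div_nonneg (neg_nonneg.2 hα.le) (by positivity)) α
  have hGm : Measurable ({α : Character A | α a < 0}.indicator
      fun α => -α a / (1 + α a ^ 2)) := by
    have hm := Character.measurable_eval a
    exact (hm.neg.div ((hm.pow_const 2).const_add 1)).indicator hneg
  have hG : Integrable ({α : Character A | α a < 0}.indicator
      fun α => -α a / (1 + α a ^ 2)) ν := by
    refine (hi a).mono hGm.aestronglyMeasurable (ae_of_all _ fun α => ?_)
    refine (norm_indicator_le_norm_self _ _).trans ?_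
    rw [norm_div, norm_neg, Real.norm_of_nonneg (by positivity : 0 ≤ 1 + α a ^ 2)]
    exact div_le_self (norm_nonneg _) (by nlinarith [sq_nonneg (α a)])
  have hle : ∀ ε > 0, ∫ α, {α : Character A | α a < 0}.indicator
      (fun α => -α a / (1 + α a ^ 2)) α ∂ν ≤ 2 * ε ^ 2 := fun ε hε => by
    obtain ⟨_, ⟨x, rfl⟩, hxε⟩ := Metric.mem_closure_iff.1 hclos ε hε
    have hsub := (hx x).sub hh
    have hn : ∫ α, (α x * √(α (1 + a ^ 2)) -
        {α : Character A | α a < 0}.indicator (fun _ => (1 : ℝ)) α) ^ 2 ∂ν =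
        ‖(hx x).toLp _ - hh.toLp _‖ ^ 2 := by
      rw [← MemLp.toLp_sub, ← real_inner_self_eq_norm_sq, L2.inner_def]
      refine integral_congr_ae ?_
      filter_upwards [hsub.coeFn_toLp] with α hα
      rw [hα, real_inner_self_eq_norm_sq, Real.norm_eq_abs, sq_abs]
      rfl
    have h1 := integral_mono (hG.add ((hi (x ^ 2 * a)).const_mul 2))
      (hsub.integrable_sq.const_mul 2) (hpt x)
    simp only [Pi.add_apply, Pi.sub_apply] at h1
    rw [integral_add hG ((hi (x ^ 2 * a)).const_mul 2), integral_const_mul, integral_const_mul,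
      hn, ← hν] at h1
    have h2 : ‖(hx x).toLp _ - hh.toLp _‖ < ε := by
      rw [← dist_eq_norm, dist_comm]
      exact hxε
    nlinarith [ha x, norm_nonneg ((hx x).toLp _ - hh.toLp _)]
  have hzero : ∫ α, {α : Character A | α a < 0}.indicator
      (fun α => -α a / (1 + α a ^ 2)) α ∂ν = 0 := by
    refine le_antisymm (le_of_forall_pos_le_add fun δ hδ => ?_) (integral_nonneg hG0)
    have := hle (√(δ / 2)) (by positivity)
    rw [Real.sq_sqrt (by positivity)] at this
    linarith
  rw [integral_eq_zero_iff_of_nonneg hG0 hG] at hzero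
  refine measure_mono_null (fun α (hα : α a < 0) => ?_) hzero
  simp only [Set.mem_compl_iff, Set.mem_ofPred_eq, Pi.zero_apply]
  rw [Set.indicator_of_mem (Set.mem_ofPred_eq.symm ▸ hα)]
  exact (div_pos (neg_pos.2 hα) (by positivity)).ne'

end RepresentingMeasures

section Support

variable {A : Type*} [CommRing A] [Algebra ℝ A]

theorem measure_compl_charNonneg_eq_zero {ν : Measure (Character A)} (hν : IsRadonMeasure ν)
    {Q : Set A} (h : ∀ a ∈ Q, ν {α : Character A | α a < 0} = 0) : ν (charNonneg Q)ᶜ = 0 := by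
  have hunion : (charNonneg Q)ᶜ = ⋃ a : Q, {α : Character A | α (a : A) < 0} := by
    ext α
    simp [charNonneg]
  rw [hunion, ← nonpos_iff_eq_zero]
  refine measure_iUnion_le_of_finset (fun U hU r hr => hν.2 hU.measurableSet r hr)
    (fun a => isOpen_lt (Character.continuous_eval _) continuous_const) fun s => ?_
  exact ((measure_biUnion_null_iff s.countable_toSet).2 fun a _ => h a a.2).le

end Support

/-- Corollary `thm-um-generating-subspace::cor`: uniqueness and
existence of a representing measure giving full mass to the `q`-continuous characters
in `K_Q`, for a nuclear generating subspace. -/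
theorem statement10 {A : Type*} [CommRing A] [Algebra ℝ A]
    (V : Submodule ℝ A) (hgen : Algebra.adjoin ℝ (V : Set A) = ⊤)
    (τ : TopologicalSpace ↥V) (hnuc : IsNuclearTopology τ)
    (L : A →ₗ[ℝ] ℝ) (hL1 : L 1 = 1) (hLsq : ∀ a : A, 0 ≤ L (a * a))
    (Q : Set A) (hQ : IsQuadraticModule Q)
    (ha : ∀ a ∈ Q, 0 ≤ L a)
    (hb : ∀ v : V, ∑' n : ℕ,
      (ENNReal.ofReal ((L ((v : A) ^ (2 * (n + 1)))) ^
        ((1 : ℝ) / (2 * (n + 1) : ℝ))))⁻¹ = ⊤)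
    (hc : @Continuous ↥V ℝ τ _ ((sLSeminorm L hLsq).comp V.subtype).toFun) :
    ∀ q : HilbSeminorm ↥V,
      (∃ α : Character A, α ∈ charNonneg Q ∧ QContOn V q.toFun α) →
      ((sLSeminorm L hLsq).comp V.subtype).trace q < ⊤ →
      ∃! ν : Measure (Character A), IsRadonMeasure ν ∧
        (∀ a : A, L a = ∫ α : Character A, α a ∂ν) ∧
        ν {α : Character A | α ∈ charNonneg Q ∧ QContOn V q.toFun α} = 1 := by
  rintro q ⟨α₀, -, -⟩ htr
  obtain ⟨ν, hRad, hP, hint, hq⟩ := exists_representing_measure hgen hL1 hLsq hb q htr α₀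
  have : ν.InnerRegular := ⟨hRad.2⟩
  have hν : ∀ a : A, L a = ∫ α : Character A, α a ∂ν := fun a => (hint a).2.symm
  have hnull := measure_compl_charNonneg_eq_zero hRad fun a haQ =>
    measure_eval_neg_eq_zero hgen hL1 hLsq hb hν fun x => ha _ (hQ.2.2 x a haQ)
  refine ⟨ν, ⟨hRad, hν, ?_⟩, fun ν' h' => ?_⟩
  · have hae : ∀ᵐ α ∂ν, α ∈ charNonneg Q ∧ QContOn V q.toFun α := by
      filter_upwards [hq, mem_ae_iff.2 hnull] with α h1 h2 using ⟨h2, h1⟩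
    rw [measure_congr (Filter.eventuallyEq_univ.2 hae), measure_univ]
  · have : ν'.InnerRegular := ⟨h'.1.2⟩
    exact eq_of_integral_eval_eq hgen hL1 hLsq hb h'.2.1 hν
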